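/- Let m>0 and let f: ℝ³ → ℂ be a Schwartz function. Define the Klein–Gordon wave packet u(x) = (2π)^{-3/2} ∫_{ℝ³} f(p⃗) e^{-i(x⁰ω_m(p⃗) − x⃗·p⃗)} (m/ω_m(p⃗)) d³p⃗ for x ∈ ℝ⁴. Then there exists a sequence (L_k)_{k≥0} of linear partial differential operators in the variable u⃗ ∈ ℝ³, independent of f and m, with L₀ the identity, each L_k of order at most 2k and with coefficients that are real polynomials of degree at most 2k in the components of ((1+|u⃗|²)^{1/2}, u⃗), such that: for every integer N ≥ 0 there is a constant C (depending on f, m, N) with (i) for every x ∈ ℝ⁴ with x·x ≥ 1, writing λ = sgn(x⁰)(x·x)^{1/2} and u⃗ = x⃗/λ, one has |u(x) − e^{-i(mλ + sgn(λ)·3π/4)} (m/|λ|)^{3/2} Σ_{k=0}^{N} (−i/(mλ))^k (L_k g)(u⃗)| ≤ C(1+|x|)^{-N-5/2}, where g(u⃗) = f(m u⃗); and (ii) for every x ∈ ℝ⁴ with x·x < 1, |u(x)| ≤ C(1+|x|)^{-N-5/2}. -/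

import Mathlib

/-!
Statement 0: asymptotic expansion of a Klein–Gordon wave packet
`u(x) = (2π)^{-3/2} ∫ f(p⃗) e^{-i(x⁰ω_m(p⃗) − x⃗·p⃗)} (m/ω_m(p⃗)) d³p⃗`
in timelike directions, with a universal sequence of differential operators `L_k`
of order at most `2k` whose coefficients are real polynomials of degree at most `2k`
in the components of `((1+|u⃗|²)^{1/2}, u⃗)`.
-/

open MeasureTheory Real Complex
open scoped InnerProductSpace

noncomputable section

abbrev V3 := EuclideanSpace ℝ (Fin 3)

/-- Iterated coordinate partial derivatives `∂_{i₁} ⋯ ∂_{iₙ}` along a list of directions. -/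
def pderivList : List (Fin 3) → (V3 → ℂ) → (V3 → ℂ)
  | [], g => g
  | (i :: ls), g => fun u => fderiv ℝ (pderivList ls g) u (EuclideanSpace.single i 1)

/-- A linear partial differential operator with polynomial coefficients: the sum over a
finite set of multi-indices (encoded as lists of coordinate directions) of the corresponding
iterated partial derivative multiplied by a real polynomial in the four components of
`((1+|u⃗|²)^{1/2}, u⃗)`. -/
def applyOp (S : Finset (List (Fin 3))) (c : List (Fin 3) → MvPolynomial (Fin 4) ℝ)
    (g : V3 → ℂ) (u : V3) : ℂ :=
  ∑ ls ∈ S,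
    ((MvPolynomial.eval (![Real.sqrt (1 + ‖u‖ ^ 2), u 0, u 1, u 2]) (c ls) : ℝ) : ℂ) *
      pderivList ls g u

/-- The Klein–Gordon wave packet with momentum profile `f` at the spacetime point
`x = (x0, xv)`. -/
def wavePacket (m : ℝ) (f : SchwartzMap V3 ℂ) (x0 : ℝ) (xv : V3) : ℂ :=
  (((2 * π) ^ (-(3 : ℝ) / 2) : ℝ) : ℂ) *
    ∫ p : V3, f p *
      Complex.exp (-Complex.I * ((x0 * Real.sqrt (m ^ 2 + ‖p‖ ^ 2) - ⟪xv, p⟫_ℝ : ℝ) : ℂ)) *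
      (((m / Real.sqrt (m ^ 2 + ‖p‖ ^ 2) : ℝ)) : ℂ)

open Filter Topology
open scoped SchwartzMap FourierTransform

/-! ### The mass-one dispersion relation and Schwartz multipliers -/

/-- The energy `ω(q) = (1 + |q|²)^{1/2}` on the unit mass shell. -/
def om (q : V3) : ℝ := Real.sqrt (1 + ‖q‖ ^ 2)

lemma om_sq (q : V3) : om q ^ 2 = 1 + ‖q‖ ^ 2 := Real.sq_sqrt (by positivity)

lemma one_le_om (q : V3) : 1 ≤ om q := by
  rw [om, Real.one_le_sqrt]; nlinarith [sq_nonneg ‖q‖]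

lemma om_pos (q : V3) : 0 < om q := lt_of_lt_of_le one_pos (one_le_om q)

lemma norm_le_om (q : V3) : ‖q‖ ≤ om q := Real.le_sqrt_of_sq_le (by linarith)

lemma continuous_om : Continuous om := by unfold om; fun_prop

lemma norm_sq_V3 (q : V3) : ‖q‖ ^ 2 = ∑ j, q j ^ 2 := EuclideanSpace.real_norm_sq_eq q

lemma inner_V3 (x q : V3) : ⟪x, q⟫_ℝ = ∑ j, x j * q j := by
  simp [PiLp.inner_apply, mul_comm]

/-- The coordinate basis vector. -/
def ej (j : Fin 3) : V3 := EuclideanSpace.single j 1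

@[simp] lemma inner_ej (q : V3) (j : Fin 3) : ⟪q, ej j⟫_ℝ = q j := by
  simp [ej, EuclideanSpace.inner_single_right]

@[simp] lemma ej_apply (i j : Fin 3) : ej j i = if i = j then 1 else 0 := by
  simp [ej]

lemma hasFDerivAt_one_add_norm_sq (q : V3) :
    HasFDerivAt (fun q : V3 => 1 + ‖q‖ ^ 2) ((2 : ℝ) • innerSL ℝ q) q := by
  exact ((hasStrictFDerivAt_norm_sq q).hasFDerivAt.const_add 1).congr_fderiv (by ext; simp)

lemma hasFDerivAt_om (q : V3) : HasFDerivAt om ((om q)⁻¹ • innerSL ℝ q) q := by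
  have h := (hasFDerivAt_one_add_norm_sq q).sqrt (by positivity)
  refine h.congr_fderiv ?_
  ext v
  simp only [smul_smul, om]
  congr 2
  field_simp

lemma om_hasTemperateGrowth : Function.HasTemperateGrowth om := by
  have := Function.hasTemperateGrowth_one_add_norm_sq_rpow V3 (1 / 2)
  have e : om = fun q : V3 => (1 + ‖q‖ ^ 2) ^ (1 / 2 : ℝ) := by
    ext q; rw [om, Real.sqrt_eq_rpow]
  rwa [e]

lemma om_inv_hasTemperateGrowth : Function.HasTemperateGrowth (fun q => (om q)⁻¹) := by
  have := Function.hasTemperateGrowth_one_add_norm_sq_rpow V3 (-(1 / 2))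
  have e : (fun q => (om q)⁻¹) = fun q : V3 => (1 + ‖q‖ ^ 2) ^ (-(1 / 2) : ℝ) := by
    ext q; rw [om, Real.sqrt_eq_rpow, Real.rpow_neg (by positivity)]
  rwa [e]

lemma coord_hasTemperateGrowth (j : Fin 3) :
    Function.HasTemperateGrowth (fun q : V3 => q j) := by
  simpa using Function.hasTemperateGrowth_inner_left (ej j)

/-- Multiplication of Schwartz functions by a real function of temperate growth. -/
def mulS (a : V3 → ℝ) : 𝓢(V3, ℂ) →ₗ[ℂ] 𝓢(V3, ℂ) :=
  (SchwartzMap.smulLeftCLM ℂ (fun q => (a q : ℂ))).toLinearMap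

lemma mulS_apply {a : V3 → ℝ} (ha : Function.HasTemperateGrowth a) (f : 𝓢(V3, ℂ)) (q : V3) :
    mulS a f q = a q * f q := by
  have : Function.HasTemperateGrowth (fun q => (a q : ℂ)) :=
    Function.HasTemperateGrowth.comp (Function.RCLike.hasTemperateGrowth_ofReal (𝕜 := ℂ)) ha
  simp [mulS, SchwartzMap.smulLeftCLM_apply_apply this]

/-- Multiplication by the coordinate `q_j`. -/
def Qm (j : Fin 3) : 𝓢(V3, ℂ) →ₗ[ℂ] 𝓢(V3, ℂ) := mulS (fun q => q j)

/-- Multiplication by the energy. -/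
def Om : 𝓢(V3, ℂ) →ₗ[ℂ] 𝓢(V3, ℂ) := mulS om

/-- Multiplication by the inverse energy. -/
def Oi : 𝓢(V3, ℂ) →ₗ[ℂ] 𝓢(V3, ℂ) := mulS (fun q => (om q)⁻¹)

/-- The partial derivative `∂_j`. -/
def Pd (j : Fin 3) : 𝓢(V3, ℂ) →ₗ[ℂ] 𝓢(V3, ℂ) :=
  (LineDeriv.lineDerivOpCLM ℂ 𝓢(V3, ℂ) (ej j)).toLinearMap

@[simp] lemma Qm_apply (j : Fin 3) (f : 𝓢(V3, ℂ)) (q : V3) : Qm j f q = (q j : ℂ) * f q :=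
  mulS_apply (coord_hasTemperateGrowth j) f q

@[simp] lemma Om_apply (f : 𝓢(V3, ℂ)) (q : V3) : Om f q = (om q : ℂ) * f q :=
  mulS_apply om_hasTemperateGrowth f q

@[simp] lemma Oi_apply (f : 𝓢(V3, ℂ)) (q : V3) : Oi f q = (om q : ℂ)⁻¹ * f q := by
  rw [Oi, mulS_apply om_inv_hasTemperateGrowth f q]; push_cast; rfl

lemma Pd_apply (j : Fin 3) (f : 𝓢(V3, ℂ)) (q : V3) : Pd j f q = fderiv ℝ f q (ej j) := by
  simp [Pd, SchwartzMap.lineDerivOp_apply_eq_fderiv]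

lemma hasFDerivAt_schwartz (f : 𝓢(V3, ℂ)) (q : V3) : HasFDerivAt f (fderiv ℝ f q) q :=
  (f.differentiableAt).hasFDerivAt

lemma Pd_Qm (i j : Fin 3) (f : 𝓢(V3, ℂ)) :
    Pd i (Qm j f) = (if i = j then f else 0) + Qm j (Pd i f) := by
  ext q
  have h : HasFDerivAt (fun q : V3 => (q j : ℂ) * f q) _ q :=
    ((Complex.ofRealCLM.hasFDerivAt.comp q
      (EuclideanSpace.proj (𝕜 := ℝ) (ι := Fin 3) j : V3 →L[ℝ] ℝ).hasFDerivAt)).mul (hasFDerivAt_schwartz f q)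
  have e : (⇑(Qm j f)) = fun q : V3 => (q j : ℂ) * f q := funext fun q => Qm_apply j f q
  rw [Pd_apply, e, h.fderiv]
  by_cases hij : i = j
  · subst hij; simp [Pd_apply]; ring
  · simp [Pd_apply, hij, Ne.symm hij]

lemma Pd_Om (j : Fin 3) (f : 𝓢(V3, ℂ)) :
    Pd j (Om f) = Qm j (Oi f) + Om (Pd j f) := by
  ext q
  have h : HasFDerivAt (fun q : V3 => (om q : ℂ) * f q) _ q :=
    (Complex.ofRealCLM.hasFDerivAt.comp q (hasFDerivAt_om q)).mul (hasFDerivAt_schwartz f q)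
  have e : (⇑(Om f)) = fun q : V3 => (om q : ℂ) * f q := funext fun q => Om_apply f q
  rw [Pd_apply, e, h.fderiv]
  simp [Pd_apply]; ring

lemma om_ne (q : V3) : (om q : ℂ) ≠ 0 := by exact_mod_cast (om_pos q).ne'

lemma Om_Oi (f : 𝓢(V3, ℂ)) : Om (Oi f) = f := by
  ext q
  rw [Om_apply, Oi_apply, mul_inv_cancel_left₀ (om_ne q)]

lemma Oi_Om (f : 𝓢(V3, ℂ)) : Oi (Om f) = f := by
  ext q
  rw [Oi_apply, Om_apply, inv_mul_cancel_left₀ (om_ne q)]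

/-! ### Weighted oscillatory integrals and integration by parts -/

/-- The phase factor `exp(-i(x⁰ω(q) - x·q))`. -/
def ph (x0 : ℝ) (x q : V3) : ℂ :=
  Complex.exp (-Complex.I * ((x0 * om q - ⟪x, q⟫_ℝ : ℝ) : ℂ))

lemma norm_ph (x0 : ℝ) (x q : V3) : ‖ph x0 x q‖ = 1 := by
  rw [ph, ← Complex.norm_exp_ofReal_mul_I (-(x0 * om q - ⟪x, q⟫_ℝ))]
  congr 2; push_cast; ring

lemma continuous_ph (x0 : ℝ) (x : V3) : Continuous (ph x0 x) := by
  have := continuous_om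
  unfold ph; fun_prop

lemma hasFDerivAt_ph (x0 : ℝ) (x q : V3) :
    HasFDerivAt (ph x0 x)
      ((ph x0 x q * (-Complex.I)) •
        (Complex.ofRealCLM ∘L (x0 • ((om q)⁻¹ • innerSL ℝ q) - innerSL ℝ x))) q := by
  have h1 : HasFDerivAt (fun q : V3 => x0 * om q - ⟪x, q⟫_ℝ)
      (x0 • ((om q)⁻¹ • innerSL ℝ q) - innerSL ℝ x) q :=
    ((hasFDerivAt_om q).const_mul x0).sub (innerSL ℝ x).hasFDerivAt
  have h2 := ((Complex.ofRealCLM.hasFDerivAt.comp q h1).const_mul (-Complex.I)).cexp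
  refine h2.congr_fderiv ?_
  ext v
  simp [ph]
  ring

/-- The weight `(1 + θ²|q|²)⁻¹`. -/
def kap (θ : ℝ) (q : V3) : ℝ := (1 + θ ^ 2 * ‖q‖ ^ 2)⁻¹

lemma kap_pos (θ : ℝ) (q : V3) : 0 < kap θ q := by unfold kap; positivity

lemma kap_le_one (θ : ℝ) (q : V3) : kap θ q ≤ 1 := by
  unfold kap; exact inv_le_one_of_one_le₀ (by nlinarith [mul_nonneg (sq_nonneg θ) (sq_nonneg ‖q‖)])

lemma continuous_kap (θ : ℝ) : Continuous (kap θ) := by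
  unfold kap
  exact Continuous.inv₀ (by fun_prop) (fun q => by positivity)

lemma hasFDerivAt_kap (θ : ℝ) (q : V3) :
    HasFDerivAt (kap θ) ((-(2 * θ ^ 2) * kap θ q ^ 2) • innerSL ℝ q) q := by
  have h1 : HasFDerivAt (fun q : V3 => 1 + θ ^ 2 * ‖q‖ ^ 2) (θ ^ 2 • (2 • innerSL ℝ q)) q :=
    ((hasStrictFDerivAt_norm_sq q).hasFDerivAt.const_mul (θ ^ 2)).const_add 1
  have h2 := (hasDerivAt_inv (x := 1 + θ ^ 2 * ‖q‖ ^ 2) (by positivity)).comp_hasFDerivAt q h1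
  refine h2.congr_fderiv ?_
  ext v
  simp [kap]
  ring

lemma integrable_phase (θ : ℝ) (b : ℕ) (x0 : ℝ) (x : V3) (f : 𝓢(V3, ℂ)) :
    Integrable (fun q => f q * (ph x0 x q * ((kap θ q ^ b : ℝ) : ℂ))) := by
  refine f.integrable.mul_bdd (c := 1) ?_ ?_
  · have h1 := continuous_ph x0 x
    have h2 := continuous_kap θ
    exact (by fun_prop : Continuous _).aestronglyMeasurable
  · refine Filter.Eventually.of_forall fun q => ?_
    rw [norm_mul, norm_ph, one_mul, Complex.norm_real, Real.norm_of_nonneg (by have := kap_pos θ q; positivity)]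
    exact pow_le_one₀ (kap_pos θ q).le (kap_le_one θ q)

/-- The weighted oscillatory integral `∫ f e^{-i(x⁰ω - x·q)} (1+θ²|q|²)^{-b} ω⁻¹ dq`. -/
def Wt (θ : ℝ) (b : ℕ) (x0 : ℝ) (x : V3) : 𝓢(V3, ℂ) →ₗ[ℂ] ℂ where
  toFun f := ∫ q, Oi f q * (ph x0 x q * ((kap θ q ^ b : ℝ) : ℂ))
  map_add' f g := by
    rw [← integral_add (integrable_phase ..) (integrable_phase ..)]
    simp only [map_add, add_apply, add_mul]
  map_smul' c f := by
    rw [RingHom.id_apply, smul_eq_mul, ← integral_const_mul]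
    simp only [map_smul, smul_apply, smul_eq_mul, mul_assoc]

lemma Wt_def (θ : ℝ) (b : ℕ) (x0 : ℝ) (x : V3) (f : 𝓢(V3, ℂ)) :
    Wt θ b x0 x f = ∫ q, Oi f q * (ph x0 x q * ((kap θ q ^ b : ℝ) : ℂ)) := rfl

lemma norm_Wt_le (f : 𝓢(V3, ℂ)) :
    ∃ C, 0 ≤ C ∧ ∀ θ b x0 x, ‖Wt θ b x0 x f‖ ≤ C := by
  refine ⟨∫ q, ‖Oi f q‖, integral_nonneg fun _ => norm_nonneg _, fun θ b x0 x => ?_⟩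
  rw [Wt_def]
  refine norm_integral_le_of_norm_le (Oi f).integrable.norm (Filter.Eventually.of_forall fun q => ?_)
  rw [norm_mul, norm_mul, norm_ph, one_mul, Complex.norm_real,
    Real.norm_of_nonneg (by have := kap_pos θ q; positivity)]
  exact mul_le_of_le_one_right (norm_nonneg _) (pow_le_one₀ (kap_pos θ q).le (kap_le_one θ q))

/-- Raising the weight exponent by one. -/
lemma Wt_succ (θ : ℝ) (b : ℕ) (x0 : ℝ) (x : V3) (f : 𝓢(V3, ℂ)) :
    Wt θ b x0 x f = Wt θ (b + 1) x0 x (f + (θ ^ 2 : ℂ) • ∑ j, Qm j (Qm j f)) := by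
  rw [Wt_def, Wt_def]
  refine integral_congr_ae (Filter.Eventually.of_forall fun q => ?_)
  have h : (1 + (θ : ℂ) ^ 2 * ∑ j, (q j : ℂ) ^ 2) * (kap θ q : ℂ) = 1 := by
    have : (1 + θ ^ 2 * ∑ j, q j ^ 2) * kap θ q = 1 := by
      rw [kap, norm_sq_V3, ← norm_sq_V3]; exact mul_inv_cancel₀ (by positivity)
    exact_mod_cast this
  simp only [Oi_apply, add_apply, smul_apply, sum_apply,
    Qm_apply, smul_eq_mul]
  push_cast
  rw [pow_succ (kap θ q : ℂ) b]
  have e : f q + (θ : ℂ) ^ 2 * ∑ j, (q j : ℂ) * ((q j : ℂ) * f q)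
      = (1 + (θ : ℂ) ^ 2 * ∑ j, (q j : ℂ) ^ 2) * f q := by
    simp only [Fin.sum_univ_three]; ring
  rw [e]
  linear_combination (-(om q : ℂ)⁻¹ * f q * ph x0 x q * (kap θ q : ℂ) ^ b) * h

/-- Multiplication by `b_j = x_j ω - x⁰ q_j`, the symbol of the boost generator. -/
def Bj (x0 : ℝ) (x : V3) (j : Fin 3) : 𝓢(V3, ℂ) →ₗ[ℂ] 𝓢(V3, ℂ) :=
  (x j : ℂ) • Om - (x0 : ℂ) • Qm j

@[simp] lemma Bj_apply (x0 : ℝ) (x : V3) (j : Fin 3) (f : 𝓢(V3, ℂ)) (q : V3) :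
    Bj x0 x j f q = ((x j : ℂ) * om q - x0 * q j) * f q := by
  simp [Bj]; ring

/-- Integration by parts along the boost generator `ω∂_j`. -/
lemma Wt_ibp (θ : ℝ) (b : ℕ) (x0 : ℝ) (x : V3) (j : Fin 3) (f : 𝓢(V3, ℂ)) :
    Wt θ b x0 x (Bj x0 x j f) = Complex.I * (Wt θ b x0 x (Om (Pd j f))
      - (2 * b * θ ^ 2 : ℂ) * Wt θ (b + 1) x0 x (Qm j (Om f))) := by
  set G : V3 → ℂ := fun q => ph x0 x q * ((kap θ q ^ b : ℝ) : ℂ) with hG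
  have hGd : ∀ q, HasFDerivAt G _ q := fun q =>
    (hasFDerivAt_ph x0 x q).mul (Complex.ofRealCLM.hasFDerivAt.comp q ((hasFDerivAt_kap θ q).pow b))
  have hGj : ∀ q, fderiv ℝ G q (ej j) =
      Complex.I * ((x j : ℂ) * om q - x0 * q j) * (om q : ℂ)⁻¹ * (ph x0 x q * ((kap θ q ^ b : ℝ) : ℂ))
      - (2 * b * θ ^ 2 : ℂ) * q j * (ph x0 x q * ((kap θ q ^ (b + 1) : ℝ) : ℂ)) := by
    intro q
    rw [(hGd q).fderiv]
    simp
    have h1 : (om q : ℂ) * (om q : ℂ)⁻¹ = 1 := mul_inv_cancel₀ (om_ne q)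
    rcases b with _ | b
    · simp; linear_combination (-Complex.I * x j * ph x0 x q) * h1
    · simp only [Nat.add_sub_cancel]
      push_cast
      linear_combination (-Complex.I * x j * ph x0 x q * (kap θ q) ^ (b + 1)) * h1
  have i1 := integrable_phase θ b x0 x (Pd j f)
  have i2 := integrable_phase θ b x0 x (Oi (Bj x0 x j f))
  have i3 := integrable_phase θ (b + 1) x0 x (Qm j f)
  have key : ∀ q, f q * fderiv ℝ G q (ej j) =
      Complex.I * (Oi (Bj x0 x j f) q * (ph x0 x q * ((kap θ q ^ b : ℝ) : ℂ)))
       - (2 * b * θ ^ 2 : ℂ) * (Qm j f q * (ph x0 x q * ((kap θ q ^ (b + 1) : ℝ) : ℂ))) := by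
    intro q; rw [hGj]; simp; ring
  have ibp := integral_mul_fderiv_eq_neg_fderiv_mul_of_integrable (μ := volume) (f := f) (g := G)
    (v := ej j) (by simpa [Pd_apply, hG] using i1)
    (by simp only [key]; exact (i2.const_mul _).sub (i3.const_mul _))
    (by simpa [hG] using integrable_phase θ b x0 x f)
    (fun q _ => f.differentiableAt) (fun q _ => (hGd q).differentiableAt)
  simp only [key] at ibp
  rw [integral_sub (i2.const_mul _) (i3.const_mul _), integral_const_mul, integral_const_mul] at ibp
  have e3 : Oi (Qm j (Om f)) = Qm j f := by
    ext q; simp; field_simp [om_ne q]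
  rw [Wt_def, Wt_def, Wt_def, Oi_Om, e3]
  have e4 : ∫ q, fderiv ℝ f q (ej j) * G q = ∫ q, Pd j f q * (ph x0 x q * ((kap θ q ^ b : ℝ) : ℂ)) := by
    simp only [Pd_apply, hG]
  rw [e4] at ibp
  linear_combination (-Complex.I) * ibp +
    (∫ q, Oi (Bj x0 x j f) q * (ph x0 x q * ((kap θ q ^ b : ℝ) : ℂ))) * Complex.I_sq

/-! ### Rapid decay away from the forward and backward cones -/

lemma abs_coord_le (x : V3) (j : Fin 3) : |x j| ≤ ‖x‖ := by
  simpa using PiLp.norm_apply_le x j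

lemma om_sq_complex (q : V3) : (om q : ℂ) ^ 2 = 1 + ∑ j, (q j : ℂ) ^ 2 := by
  have := om_sq q
  rw [norm_sq_V3] at this
  exact_mod_cast this

lemma sum_Bj (x0 : ℝ) (x : V3) (f : 𝓢(V3, ℂ)) :
    ∑ j, Bj x0 x j ((x0 : ℂ) • Qm j f + (x j : ℂ) • Om f)
      = ((‖x‖ ^ 2 : ℝ) : ℂ) • Om (Om f) - ((x0 ^ 2 : ℝ) : ℂ) • ∑ j, Qm j (Qm j f) := by
  ext q
  rw [norm_sq_V3]
  simp only [sum_apply, sub_apply, smul_apply, add_apply, Bj_apply, Qm_apply, Om_apply, smul_eq_mul]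
  push_cast
  simp only [Fin.sum_univ_three]
  ring

/-- The boundary terms produced by one integration by parts. -/
def ibpTerm (θ : ℝ) (b : ℕ) (x0 : ℝ) (x : V3) (j : Fin 3) (f : 𝓢(V3, ℂ)) : ℂ :=
  Complex.I * (Wt θ b x0 x (Om (Pd j f)) - (2 * b * θ ^ 2 : ℂ) * Wt θ (b + 1) x0 x (Qm j (Om f)))

lemma norm_ibpTerm_le {θ : ℝ} (hθ : θ ^ 2 ≤ 1) (b : ℕ) (x0 : ℝ) (x : V3) (j : Fin 3)
    (f : 𝓢(V3, ℂ)) :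
    ‖ibpTerm θ b x0 x j f‖ ≤ ‖Wt θ b x0 x (Om (Pd j f))‖
      + 2 * b * ‖Wt θ (b + 1) x0 x (Qm j (Om f))‖ := by
  rw [ibpTerm, norm_mul, Complex.norm_I, one_mul]
  refine (norm_sub_le _ _).trans ?_
  gcongr
  rw [norm_mul]
  gcongr
  have : ‖(2 * b * θ ^ 2 : ℂ)‖ = 2 * b * θ ^ 2 := by
    rw [← Complex.ofReal_pow]; simp
  rw [this]
  nlinarith [(Nat.cast_nonneg b : (0 : ℝ) ≤ b)]

lemma Wt_sum_Bj (θ : ℝ) (b : ℕ) (x0 : ℝ) (x : V3) (f : 𝓢(V3, ℂ)) :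
    Wt θ b x0 x (((‖x‖ ^ 2 : ℝ) : ℂ) • Om (Om f) - ((x0 ^ 2 : ℝ) : ℂ) • ∑ j, Qm j (Qm j f))
      = ∑ j, (x0 * ibpTerm θ b x0 x j (Qm j f) + x j * ibpTerm θ b x0 x j (Om f)) := by
  rw [← sum_Bj, map_sum]
  refine Finset.sum_congr rfl fun j _ => ?_
  simp only [map_add, map_smul, Wt_ibp, smul_eq_mul, ibpTerm]

lemma norm_Wt_sum_Bj_le {θ : ℝ} (hθ : θ ^ 2 ≤ 1) (b : ℕ) {x0 r : ℝ} {x : V3} (h0 : |x0| ≤ r)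
    (hx : ‖x‖ ≤ r) (f : 𝓢(V3, ℂ)) :
    ‖Wt θ b x0 x (((‖x‖ ^ 2 : ℝ) : ℂ) • Om (Om f) - ((x0 ^ 2 : ℝ) : ℂ) • ∑ j, Qm j (Qm j f))‖
      ≤ r * ∑ j, ((‖Wt θ b x0 x (Om (Pd j (Qm j f)))‖
          + 2 * b * ‖Wt θ (b + 1) x0 x (Qm j (Om (Qm j f)))‖)
        + (‖Wt θ b x0 x (Om (Pd j (Om f)))‖
          + 2 * b * ‖Wt θ (b + 1) x0 x (Qm j (Om (Om f)))‖)) := by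
  rw [Wt_sum_Bj, Finset.mul_sum]
  refine norm_sum_le_of_le _ fun j _ => ?_
  refine (norm_add_le _ _).trans ?_
  rw [mul_add, norm_mul, norm_mul, Complex.norm_real, Complex.norm_real]
  have hj : ‖x j‖ ≤ r := (abs_coord_le x j).trans hx
  have hr : 0 ≤ r := (abs_nonneg _).trans h0
  gcongr
  · exact h0
  · exact norm_ibpTerm_le hθ ..
  · exact norm_ibpTerm_le hθ ..

lemma spacelike_decay (M : ℕ) : ∀ (b : ℕ) (f : 𝓢(V3, ℂ)), ∃ C, 0 ≤ C ∧
    ∀ (θ x0 : ℝ) (x : V3), |x0| ≤ ‖x‖ → θ ^ 2 ≤ 1 → θ ^ 2 * ‖x‖ ^ 2 = ‖x‖ ^ 2 - x0 ^ 2 →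
      ‖x‖ ^ M * ‖Wt θ b x0 x f‖ ≤ C := by
  induction M with
  | zero =>
    intro b f
    obtain ⟨C, hC, h⟩ := norm_Wt_le f
    exact ⟨C, hC, fun θ x0 x _ _ _ => by simpa using h θ b x0 x⟩
  | succ M ih =>
    intro b f
    choose C hC0 hC using ih
    refine ⟨∑ j, ((C (b + 1) (Om (Pd j (Qm j f)))
          + 2 * (b + 1 : ℕ) * C (b + 2) (Qm j (Om (Qm j f))))
        + (C (b + 1) (Om (Pd j (Om f)))
          + 2 * (b + 1 : ℕ) * C (b + 2) (Qm j (Om (Om f))))),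
      Finset.sum_nonneg fun j _ => by
        have := hC0 (b + 1) (Om (Pd j (Qm j f)))
        have := hC0 (b + 2) (Qm j (Om (Qm j f)))
        have := hC0 (b + 1) (Om (Pd j (Om f)))
        have := hC0 (b + 2) (Qm j (Om (Om f)))
        positivity, fun θ x0 x hx hθ he => ?_⟩
    rcases (norm_nonneg x).eq_or_lt' with hr | hr
    · rw [hr]
      simp only [ne_eq, Nat.add_eq_zero_iff, one_ne_zero, and_false, not_false_eq_true, zero_pow, zero_mul]
      exact Finset.sum_nonneg fun j _ => by
        have := hC0 (b + 1) (Om (Pd j (Qm j f)))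
        have := hC0 (b + 2) (Qm j (Om (Qm j f)))
        have := hC0 (b + 1) (Om (Pd j (Om f)))
        have := hC0 (b + 2) (Qm j (Om (Om f)))
        positivity
    have key : ((‖x‖ ^ 2 : ℝ) : ℂ) * Wt θ b x0 x f = Wt θ (b + 1) x0 x
        (((‖x‖ ^ 2 : ℝ) : ℂ) • Om (Om f) - ((x0 ^ 2 : ℝ) : ℂ) • ∑ j, Qm j (Qm j f)) := by
      rw [Wt_succ, ← smul_eq_mul, ← map_smul]
      congr 1
      ext q
      have he' : ((θ ^ 2 * ‖x‖ ^ 2 : ℝ) : ℂ) = ((‖x‖ ^ 2 - x0 ^ 2 : ℝ) : ℂ) := by rw [he]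
      push_cast at he'
      simp only [sum_apply, sub_apply, smul_apply, add_apply, Qm_apply, Om_apply, smul_eq_mul]
      push_cast
      have e : ∑ j, (q j : ℂ) * ((q j : ℂ) * f q) = (∑ j, (q j : ℂ) ^ 2) * f q := by
        simp only [Fin.sum_univ_three]; ring
      rw [e]
      linear_combination ((∑ j, (q j : ℂ) ^ 2) * f q) * he' - ((‖x‖ : ℂ) ^ 2 * f q) * om_sq_complex q
    have hb := norm_Wt_sum_Bj_le hθ (b + 1) hx le_rfl f
    rw [← key, norm_mul, Complex.norm_real, Real.norm_of_nonneg (by positivity), sq, mul_assoc] at hb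
    have hb' := le_of_mul_le_mul_left hb hr
    calc ‖x‖ ^ (M + 1) * ‖Wt θ b x0 x f‖ = ‖x‖ ^ M * (‖x‖ * ‖Wt θ b x0 x f‖) := by ring
      _ ≤ _ := mul_le_mul_of_nonneg_left hb' (by positivity)
      _ = ∑ j, ((‖x‖ ^ M * ‖Wt θ (b + 1) x0 x (Om (Pd j (Qm j f)))‖
          + 2 * (b + 1 : ℕ) * (‖x‖ ^ M * ‖Wt θ (b + 2) x0 x (Qm j (Om (Qm j f)))‖))
        + (‖x‖ ^ M * ‖Wt θ (b + 1) x0 x (Om (Pd j (Om f)))‖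
          + 2 * (b + 1 : ℕ) * (‖x‖ ^ M * ‖Wt θ (b + 2) x0 x (Qm j (Om (Om f)))‖))) := by
        rw [Finset.mul_sum]
        refine Finset.sum_congr rfl fun j _ => ?_
        ring
      _ ≤ _ := by
        gcongr with j _
        all_goals exact hC _ _ _ _ _ hx hθ he

/-- The Klein–Gordon integral `∫ f e^{-i(x⁰ω - x·q)} ω⁻¹ dq`. -/
def Wf (x0 : ℝ) (x : V3) : 𝓢(V3, ℂ) →ₗ[ℂ] ℂ := Wt 0 0 x0 x

lemma Wf_eq (θ : ℝ) (x0 : ℝ) (x : V3) (f : 𝓢(V3, ℂ)) : Wt θ 0 x0 x f = Wf x0 x f := by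
  simp [Wf, Wt_def]

lemma Wf_def (x0 : ℝ) (x : V3) (f : 𝓢(V3, ℂ)) : Wf x0 x f = ∫ q, Oi f q * ph x0 x q := by
  simp [Wf, Wt_def]

lemma Wf_ibp (x0 : ℝ) (x : V3) (j : Fin 3) (f : 𝓢(V3, ℂ)) :
    Wf x0 x (Bj x0 x j f) = Complex.I * Wf x0 x (Om (Pd j f)) := by
  simp [Wf, Wt_ibp]

lemma Wf_spacelike (M : ℕ) (f : 𝓢(V3, ℂ)) : ∃ C, 0 ≤ C ∧
    ∀ (x0 : ℝ) (x : V3), |x0| ≤ ‖x‖ → ‖x‖ ^ M * ‖Wf x0 x f‖ ≤ C := by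
  obtain ⟨C, hC, h⟩ := spacelike_decay M 0 f
  refine ⟨C, hC, fun x0 x hx => ?_⟩
  rcases (norm_nonneg x).eq_or_lt' with hr | hr
  · have h0 : x0 = 0 := by rw [hr] at hx; exact abs_nonpos_iff.1 hx
    have := h 0 x0 x hx (by norm_num) (by rw [hr, h0]; ring)
    rwa [Wf_eq] at this
  · have hsq : x0 ^ 2 ≤ ‖x‖ ^ 2 := by rw [← sq_abs x0]; gcongr
    have hn : 0 ≤ 1 - x0 ^ 2 / ‖x‖ ^ 2 := by
      rw [sub_nonneg, div_le_one (by positivity)]; exact hsq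
    have := h (Real.sqrt (1 - x0 ^ 2 / ‖x‖ ^ 2)) x0 x hx
      (by rw [Real.sq_sqrt hn]; linarith [show 0 ≤ x0 ^ 2 / ‖x‖ ^ 2 by positivity])
      (by rw [Real.sq_sqrt hn]; field_simp)
    rwa [Wf_eq] at this

lemma Wf_timelike (M : ℕ) : ∀ f : 𝓢(V3, ℂ), ∃ C, 0 ≤ C ∧
    ∀ (x0 : ℝ) (x : V3), ‖x‖ ≤ |x0| →
      |x0| ^ M * ‖Wf x0 x f‖ ≤ C * (1 + (x0 ^ 2 - ‖x‖ ^ 2)) ^ M := by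
  induction M with
  | zero =>
    intro f
    obtain ⟨C, hC, h⟩ := norm_Wt_le f
    exact ⟨C, hC, fun x0 x _ => by simpa [Wf] using h 0 0 x0 x⟩
  | succ M ih =>
    intro f
    choose C hC0 hC using ih
    obtain ⟨D, hD, hDb⟩ := norm_Wt_le f
    set S := ∑ j, (C (Om (Pd j (Qm j f))) + C (Om (Pd j (Om f)))) with hS
    have hS0 : 0 ≤ S := Finset.sum_nonneg fun j _ => add_nonneg (hC0 _) (hC0 _)
    refine ⟨D + (C (Om (Om f)) + S), add_nonneg hD (add_nonneg (hC0 _) hS0), fun x0 x hx => ?_⟩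
    set X := x0 ^ 2 - ‖x‖ ^ 2 with hX
    have hX0 : 0 ≤ X := by
      have : ‖x‖ ^ 2 ≤ |x0| ^ 2 := by gcongr
      rw [sq_abs] at this; linarith
    have hXM : 1 ≤ (1 + X) ^ (M + 1) := one_le_pow₀ (by linarith)
    rcases le_total |x0| 1 with h1 | h1
    · calc |x0| ^ (M + 1) * ‖Wf x0 x f‖ ≤ 1 * D := by
            gcongr
            · exact pow_le_one₀ (abs_nonneg _) h1
            · exact hDb 0 0 x0 x
        _ ≤ (D + (C (Om (Om f)) + S)) * (1 + X) ^ (M + 1) := by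
            nlinarith [hC0 (Om (Om f)), mul_nonneg (add_nonneg (hC0 (Om (Om f))) hS0) (by linarith : 0 ≤ (1 + X) ^ (M + 1)), mul_nonneg hD (by linarith : 0 ≤ (1 + X) ^ (M + 1) - 1)]
    have key : ((x0 ^ 2 : ℝ) : ℂ) * Wf x0 x f = (X : ℂ) * Wf x0 x (Om (Om f)) + Wt 0 0 x0 x
        (((‖x‖ ^ 2 : ℝ) : ℂ) • Om (Om f) - ((x0 ^ 2 : ℝ) : ℂ) • ∑ j, Qm j (Qm j f)) := by
      rw [Wf, ← smul_eq_mul, ← smul_eq_mul, ← map_smul, ← map_smul, ← map_add]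
      congr 1
      ext q
      simp only [sum_apply, sub_apply, smul_apply, add_apply, Qm_apply, Om_apply, smul_eq_mul, hX]
      push_cast
      have e : ∑ j, (q j : ℂ) * ((q j : ℂ) * f q) = (∑ j, (q j : ℂ) ^ 2) * f q := by
        simp only [Fin.sum_univ_three]; ring
      rw [e]
      linear_combination (-(x0 : ℂ) ^ 2 * f q) * om_sq_complex q
    have hb := norm_Wt_sum_Bj_le (θ := 0) (by norm_num) 0 le_rfl hx f
    simp only [Nat.cast_zero, mul_zero, zero_mul, add_zero] at hb
    have hn : |x0| * (|x0| * ‖Wf x0 x f‖) ≤ X * ‖Wf x0 x (Om (Om f))‖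
        + |x0| * ∑ j, (‖Wf x0 x (Om (Pd j (Qm j f)))‖ + ‖Wf x0 x (Om (Pd j (Om f)))‖) := by
      have : |x0| * (|x0| * ‖Wf x0 x f‖) = ‖((x0 ^ 2 : ℝ) : ℂ) * Wf x0 x f‖ := by
        rw [norm_mul, Complex.norm_real, Real.norm_of_nonneg (by positivity), ← sq_abs]; ring
      rw [this, key]
      refine (norm_add_le _ _).trans ?_
      rw [norm_mul, Complex.norm_real, Real.norm_of_nonneg hX0]
      gcongr
      exact hb
    have hxp : 0 < |x0| := by linarith
    have hn2 : |x0| * ‖Wf x0 x f‖ ≤ X * ‖Wf x0 x (Om (Om f))‖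
        + ∑ j, (‖Wf x0 x (Om (Pd j (Qm j f)))‖ + ‖Wf x0 x (Om (Pd j (Om f)))‖) := by
      refine le_of_mul_le_mul_left (hn.trans ?_) hxp
      rw [mul_add]
      exact add_le_add (le_mul_of_one_le_left (by positivity) h1) le_rfl
    have hXM0 : 0 ≤ (1 + X) ^ M := by positivity
    calc |x0| ^ (M + 1) * ‖Wf x0 x f‖ = |x0| ^ M * (|x0| * ‖Wf x0 x f‖) := by ring
      _ ≤ |x0| ^ M * (X * ‖Wf x0 x (Om (Om f))‖
        + ∑ j, (‖Wf x0 x (Om (Pd j (Qm j f)))‖ + ‖Wf x0 x (Om (Pd j (Om f)))‖)) := by gcongr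
      _ = X * (|x0| ^ M * ‖Wf x0 x (Om (Om f))‖)
        + ∑ j, (|x0| ^ M * ‖Wf x0 x (Om (Pd j (Qm j f)))‖ + |x0| ^ M * ‖Wf x0 x (Om (Pd j (Om f)))‖) := by
          rw [mul_add, Finset.mul_sum]
          congr 1
          · ring
          · exact Finset.sum_congr rfl fun j _ => by ring
      _ ≤ X * (C (Om (Om f)) * (1 + X) ^ M)
        + ∑ j, (C (Om (Pd j (Qm j f))) * (1 + X) ^ M + C (Om (Pd j (Om f))) * (1 + X) ^ M) := by
          exact add_le_add (mul_le_mul_of_nonneg_left (hC _ _ _ hx) hX0)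
            (Finset.sum_le_sum fun j _ => add_le_add (hC _ _ _ hx) (hC _ _ _ hx))
      _ = (X * C (Om (Om f)) + S) * (1 + X) ^ M := by
          rw [hS, add_mul, Finset.sum_mul]
          congr 1
          · ring
          · exact Finset.sum_congr rfl fun j _ => by ring
      _ ≤ (D + (C (Om (Om f)) + S)) * (1 + X) * (1 + X) ^ M := by
          gcongr
          nlinarith [hC0 (Om (Om f)), mul_nonneg hX0 hS0, mul_nonneg hX0 hD]
      _ = _ := by ring

/-! ### The radial ordinary differential equation -/

lemma Pd_Oi (j : Fin 3) (f : 𝓢(V3, ℂ)) :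
    Pd j (Oi f) = -Qm j (Oi (Oi (Oi f))) + Oi (Pd j f) := by
  have h := Pd_Om j (Oi f)
  rw [Om_Oi] at h
  have h2 : Oi (Pd j f) = Qm j (Oi (Oi (Oi f))) + Pd j (Oi f) := by
    rw [h, map_add, Oi_Om]
    congr 1
    ext q; simp; ring
  rw [h2]; abel

/-- The Laplacian of hyperbolic space in the coordinates `q`. -/
def Lap : 𝓢(V3, ℂ) →ₗ[ℂ] 𝓢(V3, ℂ) :=
  ∑ j, Pd j ∘ₗ Pd j + ∑ j, ∑ i, Qm j ∘ₗ Qm i ∘ₗ Pd j ∘ₗ Pd i + (3 : ℂ) • ∑ j, Qm j ∘ₗ Pd j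

lemma Lap_eq_sum (g : 𝓢(V3, ℂ)) :
    Lap g = ∑ j, Om (Pd j (Oi (Pd j g + ∑ i, Qm j (Qm i (Pd i g))))) := by
  ext q
  simp only [Lap, Pd_Oi, Pd_Qm, map_add, LinearMap.add_apply,
    LinearMap.comp_apply, LinearMap.smul_apply, map_neg, apply_ite, map_zero,
    smul_apply, add_apply, neg_apply, Fin.sum_univ_three, Fin.isValue, smul_eq_mul,
    Qm_apply, Om_apply, Oi_apply]
  simp
  have h := om_sq_complex q
  have h0 := om_ne q
  rw [Fin.sum_univ_three] at h
  generalize (om q : ℂ) = w at *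
  field_simp
  linear_combination (-((q 0 : ℂ) * Pd 0 g q + q 1 * Pd 1 g q + q 2 * Pd 2 g q)) * h

/-- Multiplication by `x⁰ω - x·q`. -/
def Cx (x0 : ℝ) (x : V3) : 𝓢(V3, ℂ) →ₗ[ℂ] 𝓢(V3, ℂ) :=
  (x0 : ℂ) • Om - ∑ j, (x j : ℂ) • Qm j

lemma Cx_apply (x0 : ℝ) (x : V3) (f : 𝓢(V3, ℂ)) (q : V3) :
    Cx x0 x f q = ((x0 * om q - ⟪x, q⟫_ℝ : ℝ) : ℂ) * f q := by
  simp [Cx, inner_V3, Fin.sum_univ_three]; ring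

lemma sum_Om_Pd_Oi (x0 : ℝ) (x : V3) (g : 𝓢(V3, ℂ)) :
    ∑ i, Om (Pd i (Oi ((x i : ℂ) • g - Qm i (Cx x0 x g)))) =
      ∑ i, ((x i : ℂ) • Pd i g - Qm i (Cx x0 x (Pd i g))) - (3 : ℂ) • Cx x0 x g := by
  ext q
  simp only [Cx, Pd_Oi, Pd_Qm, Pd_Om, map_add, map_sub, map_smul, LinearMap.sub_apply,
    LinearMap.add_apply, LinearMap.smul_apply, map_neg, apply_ite, map_zero,
    smul_apply, add_apply, neg_apply, sub_apply, Fin.sum_univ_three, Fin.isValue, smul_eq_mul,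
    Qm_apply, Om_apply, Oi_apply]
  simp
  have h := om_sq_complex q
  have h0 := om_ne q
  rw [Fin.sum_univ_three] at h
  generalize (om q : ℂ) = w at *
  field_simp
  linear_combination (g q * ((x 0 : ℂ) * q 0 + x 1 * q 1 + x 2 * q 2)) * h

lemma Wf_Lap (x0 : ℝ) (x : V3) (g : 𝓢(V3, ℂ)) :
    Wf x0 x (Lap g) = -Wf x0 x (Cx x0 x (Cx x0 x g)) + ((x0 ^ 2 - ‖x‖ ^ 2 : ℝ) : ℂ) * Wf x0 x g
      - 3 * Complex.I * Wf x0 x (Cx x0 x g) := by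
  have ibp : ∀ j h, Wf x0 x (Om (Pd j h)) = -Complex.I * Wf x0 x (Bj x0 x j h) := fun j h => by
    rw [Wf_ibp, ← mul_assoc, neg_mul, Complex.I_mul_I]; ring
  have h1 : ∑ j, Bj x0 x j (Oi (Pd j g + ∑ i, Qm j (Qm i (Pd i g)))) =
      ∑ i, ((x i : ℂ) • Pd i g - Qm i (Cx x0 x (Pd i g))) := by
    ext q
    have h := om_sq_complex q
    have h0 := om_ne q
    rw [Fin.sum_univ_three] at h
    simp only [Cx, LinearMap.sub_apply, LinearMap.add_apply, LinearMap.smul_apply,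
      smul_apply, add_apply, sub_apply, Fin.sum_univ_three, Fin.isValue, smul_eq_mul,
      Qm_apply, Om_apply, Oi_apply, Bj_apply]
    generalize (om q : ℂ) = w at *
    field_simp
    linear_combination (x0 * ((q 0 : ℂ) * Pd 0 g q + q 1 * Pd 1 g q + q 2 * Pd 2 g q)) * h
  have h2 : ∑ i, Bj x0 x i (Oi ((x i : ℂ) • g - Qm i (Cx x0 x g))) =
      Cx x0 x (Cx x0 x g) - ((x0 ^ 2 - ‖x‖ ^ 2 : ℝ) : ℂ) • g := by
    ext q
    have h := om_sq_complex q
    have h0 := om_ne q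
    rw [Fin.sum_univ_three] at h
    rw [norm_sq_V3]
    simp only [Cx, LinearMap.sub_apply, LinearMap.add_apply, LinearMap.smul_apply,
      smul_apply, add_apply, sub_apply, Fin.sum_univ_three, Fin.isValue, smul_eq_mul,
      Qm_apply, Om_apply, Oi_apply, Bj_apply]
    push_cast
    generalize (om q : ℂ) = w at *
    field_simp
    linear_combination (g q * x0 * (((x 0 : ℂ) * q 0 + x 1 * q 1 + x 2 * q 2) - w * x0)) * h
  have e1 : Wf x0 x (Lap g) =
      -Complex.I * Wf x0 x (∑ i, ((x i : ℂ) • Pd i g - Qm i (Cx x0 x (Pd i g)))) := by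
    rw [Lap_eq_sum, ← h1, map_sum, map_sum, Finset.mul_sum]
    exact Finset.sum_congr rfl fun j _ => ibp j _
  have e2 : Wf x0 x (∑ i, Om (Pd i (Oi ((x i : ℂ) • g - Qm i (Cx x0 x g))))) =
      -Complex.I * Wf x0 x (Cx x0 x (Cx x0 x g) - ((x0 ^ 2 - ‖x‖ ^ 2 : ℝ) : ℂ) • g) := by
    rw [← h2, map_sum, map_sum, Finset.mul_sum]
    exact Finset.sum_congr rfl fun j _ => ibp j _
  rw [sum_Om_Pd_Oi, map_sub, map_sub, map_smul, map_smul] at e2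
  simp only [smul_eq_mul] at e2
  rw [e1]
  linear_combination (-Complex.I) * e2 + (Wf x0 x (Cx x0 x (Cx x0 x g)) -
    ((x0 ^ 2 - ‖x‖ ^ 2 : ℝ) : ℂ) * Wf x0 x g) * Complex.I_sq

/-- The Klein–Gordon integral along the ray `σ s (ω(u), u)`. -/
def Wray (σ : ℝ) (u : V3) (g : 𝓢(V3, ℂ)) (s : ℝ) : ℂ := Wf (σ * s * om u) ((σ * s) • u) g

lemma ph_ray (σ : ℝ) (u q : V3) (s : ℝ) :
    ph (σ * s * om u) ((σ * s) • u) q =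
      Complex.exp (s * (-Complex.I * σ * ((om u * om q - ⟪u, q⟫_ℝ : ℝ) : ℂ))) := by
  rw [ph, inner_smul_left]
  congr 1
  push_cast
  simp
  ring

lemma hasDerivAt_Wray (σ : ℝ) (u : V3) (g : 𝓢(V3, ℂ)) (s : ℝ) :
    HasDerivAt (Wray σ u g) (-Complex.I * σ * Wray σ u (Cx (om u) u g) s) s := by
  have hfun : Wray σ u g = fun s => ∫ q, Oi g q * ph (σ * s * om u) ((σ * s) • u) q := by
    ext s; rw [Wray, Wf_def]
  have hval : -Complex.I * σ * Wray σ u (Cx (om u) u g) s =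
      ∫ q, -Complex.I * σ * (Oi (Cx (om u) u g) q * ph (σ * s * om u) ((σ * s) • u) q) := by
    rw [Wray, Wf_def, integral_const_mul]
  rw [hfun, hval]
  have hint : ∀ (f : 𝓢(V3, ℂ)) (s : ℝ), Integrable (fun q => f q * ph (σ * s * om u) ((σ * s) • u) q) :=
    fun f s => by simpa using integrable_phase 0 0 (σ * s * om u) ((σ * s) • u) f
  refine (hasDerivAt_integral_of_dominated_loc_of_deriv_le (F := fun s q => Oi g q * ph (σ * s * om u) ((σ * s) • u) q)
    (F' := fun s q => -Complex.I * σ * (Oi (Cx (om u) u g) q * ph (σ * s * om u) ((σ * s) • u) q))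
    (bound := fun q => ‖σ‖ * ‖Oi (Cx (om u) u g) q‖)
    (s := Set.univ) Filter.univ_mem ?_ (hint _ s) ?_ ?_ ?_ ?_).2
  · exact Filter.Eventually.of_forall fun s => (hint _ s).aestronglyMeasurable
  · exact ((hint _ s).const_mul _).aestronglyMeasurable
  · refine Filter.Eventually.of_forall fun q t _ => ?_
    simp [norm_ph]
  · exact (Oi (Cx (om u) u g)).integrable.norm.const_mul _
  · refine Filter.Eventually.of_forall fun q t _ => ?_
    simp only [ph_ray, Oi_apply, Cx_apply]
    have h := (((Complex.ofRealCLM.hasDerivAt (x := t)).mul_const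
      (-Complex.I * σ * ((om u * om q - ⟪u, q⟫_ℝ : ℝ) : ℂ))).cexp).const_mul ((om q : ℂ)⁻¹ * g q)
    refine h.congr_deriv ?_
    simp
    ring

lemma om_sq_sub (u : V3) : om u ^ 2 - ‖u‖ ^ 2 = 1 := by rw [om_sq]; ring

lemma Wray_Lap {σ : ℝ} (hσ : σ ^ 2 = 1) (u : V3) (g : 𝓢(V3, ℂ)) (s : ℝ) :
    Wray σ u (Lap g) s = -(s : ℂ) ^ 2 * Wray σ u (Cx (om u) u (Cx (om u) u g)) s
      + (s : ℂ) ^ 2 * Wray σ u g s - 3 * Complex.I * (σ * s) * Wray σ u (Cx (om u) u g) s := by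
  have hC : ∀ f, Cx (σ * s * om u) ((σ * s) • u) f = ((σ * s : ℝ) : ℂ) • Cx (om u) u f := by
    intro f
    ext q
    rw [smul_apply, Cx_apply, Cx_apply, inner_smul_left]
    push_cast
    simp
    ring
  have hsq : (σ : ℂ) ^ 2 = 1 := by exact_mod_cast hσ
  have hX : (σ * s * om u) ^ 2 - ‖(σ * s) • u‖ ^ 2 = s ^ 2 := by
    rw [norm_smul, Real.norm_eq_abs, mul_pow |σ * s|, sq_abs]
    linear_combination (σ ^ 2 * s ^ 2) * om_sq_sub u + s ^ 2 * hσ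
  unfold Wray
  rw [Wf_Lap, hX]
  simp only [hC, map_smul, smul_eq_mul]
  push_cast
  linear_combination (-(s : ℂ) ^ 2 * Wf (σ * s * om u) ((σ * s) • u) (Cx (om u) u (Cx (om u) u g))) * hsq

/-- The rescaled amplitude `s^{3/2} W` along a ray. -/
def wv (σ : ℝ) (u : V3) (g : 𝓢(V3, ℂ)) (s : ℝ) : ℂ := ((s ^ (3 / 2 : ℝ) : ℝ) : ℂ) * Wray σ u g s

/-- The radial derivative of the rescaled amplitude. -/
def wd (σ : ℝ) (u : V3) (g : 𝓢(V3, ℂ)) (s : ℝ) : ℂ :=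
  -Complex.I * σ * wv σ u (Cx (om u) u g) s + (3 / 2) * (s : ℂ)⁻¹ * wv σ u g s

lemma hasDerivAt_wv (σ : ℝ) (u : V3) (g : 𝓢(V3, ℂ)) {s : ℝ} (hs : 0 < s) :
    HasDerivAt (wv σ u g) (wd σ u g s) s := by
  have h1 := ((Real.hasDerivAt_rpow_const (x := s) (p := 3 / 2) (Or.inl hs.ne')).ofReal_comp).mul
    (hasDerivAt_Wray σ u g s)
  refine h1.congr_deriv ?_
  have : s ^ ((3 : ℝ) / 2 - 1) = s ^ (3 / 2 : ℝ) * s⁻¹ := by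
    rw [Real.rpow_sub hs, Real.rpow_one]; rfl
  rw [this, wd, wv, wv]
  push_cast
  ring

/-- The shifted hyperbolic Laplacian `Δ + 3/4`. -/
def Aop : 𝓢(V3, ℂ) →ₗ[ℂ] 𝓢(V3, ℂ) := Lap + (3 / 4 : ℂ) • LinearMap.id

lemma wv_linear (σ : ℝ) (u : V3) (s : ℝ) :
    IsLinearMap ℂ (fun g => wv σ u g s) :=
  ⟨fun f g => by simp only [wv, Wray, map_add]; ring,
   fun c f => by simp only [wv, Wray, map_smul, smul_eq_mul]; ring⟩

lemma hasDerivAt_wd {σ : ℝ} (hσ : σ ^ 2 = 1) (u : V3) (g : 𝓢(V3, ℂ)) {s : ℝ} (hs : 0 < s) :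
    HasDerivAt (wd σ u g) (-wv σ u g s + ((s ^ 2 : ℝ) : ℂ)⁻¹ * wv σ u (Aop g) s) s := by
  have hs' : (s : ℂ) ≠ 0 := by exact_mod_cast hs.ne'
  have h1 := (hasDerivAt_wv σ u (Cx (om u) u g) hs).const_mul (-Complex.I * σ)
  have h2 := (((hasDerivAt_inv hs.ne').ofReal_comp).const_mul (3 / 2 : ℂ)).mul
    (hasDerivAt_wv σ u g hs)
  have h3 := h1.add h2
  have e : wd σ u g = fun s => -Complex.I * σ * wv σ u (Cx (om u) u g) s +
      3 / 2 * ((s⁻¹ : ℝ) : ℂ) * wv σ u g s := by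
    ext s; rw [wd]; push_cast; ring
  rw [e]
  refine h3.congr_deriv ?_
  have hA : wv σ u (Aop g) s = wv σ u (Lap g) s + (3 / 4) * wv σ u g s := by
    rw [Aop, LinearMap.add_apply, (wv_linear σ u s).map_add, LinearMap.smul_apply,
      (wv_linear σ u s).map_smul]
    rfl
  have hσ' : (σ : ℂ) ^ 2 = 1 := by exact_mod_cast hσ
  rw [hA, wd, wd]
  simp only [wv]
  rw [Wray_Lap hσ]
  push_cast
  field_simp
  ring_nf
  simp only [Complex.I_sq, hσ']
  ring

/-! ### Uniform bounds from the radial equation -/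

/-- Variation of constants for `w'' + w = h` with a majorant `β'` of `h`. -/
lemma oscillator_step {w w1 h : ℝ → ℂ} {β β' : ℝ → ℝ} {p t : ℝ} (hpt : p ≤ t)
    (hw : ∀ y ∈ Set.Icc p t, HasDerivAt w (w1 y) y)
    (hw1 : ∀ y ∈ Set.Icc p t, HasDerivAt w1 (-w y + h y) y)
    (hβ : ∀ y ∈ Set.Icc p t, HasDerivAt β (β' y) y)
    (hb : ∀ y ∈ Set.Icc p t, ‖h y‖ ≤ β' y) (r : ℝ) :
    ‖(w t * Real.cos (t - r) - w1 t * Real.sin (t - r)) -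
      (w p * Real.cos (p - r) - w1 p * Real.sin (p - r))‖ ≤ β t - β p := by
  have hz : ∀ y ∈ Set.Icc p t, HasDerivAt
      (fun y => (w y * Real.cos (y - r) - w1 y * Real.sin (y - r)) -
        (w p * Real.cos (p - r) - w1 p * Real.sin (p - r)))
      (-(h y * Real.sin (y - r))) y := by
    intro y hy
    have hc : HasDerivAt (fun y => ((Real.cos (y - r) : ℝ) : ℂ)) ((-Real.sin (y - r) : ℝ) : ℂ) y := by
      simpa using (((hasDerivAt_id y).sub_const r).cos).ofReal_comp
    have hs : HasDerivAt (fun y => ((Real.sin (y - r) : ℝ) : ℂ)) ((Real.cos (y - r) : ℝ) : ℂ) y := by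
      simpa using (((hasDerivAt_id y).sub_const r).sin).ofReal_comp
    refine ((((hw y hy).mul hc).sub ((hw1 y hy).mul hs)).sub_const _).congr_deriv ?_
    push_cast
    ring
  refine image_norm_le_of_norm_deriv_right_le_deriv_boundary' (a := p) (b := t)
    (f := fun y => (w y * Real.cos (y - r) - w1 y * Real.sin (y - r)) -
        (w p * Real.cos (p - r) - w1 p * Real.sin (p - r)))
    (f' := fun y => -(h y * Real.sin (y - r))) (B := fun y => β y - β p) (B' := β')
    (fun y hy => (hz y hy).continuousAt.continuousWithinAt)
    (fun y hy => (hz y (Set.Ico_subset_Icc_self hy)).hasDerivWithinAt) (by simp)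
    (fun y hy => ((hβ y hy).sub_const _).continuousAt.continuousWithinAt)
    (fun y hy => ((hβ y (Set.Ico_subset_Icc_self hy)).sub_const _).hasDerivWithinAt)
    (fun y hy => ?_) (Set.right_mem_Icc.2 hpt)
  rw [norm_neg, norm_mul, Complex.norm_real]
  refine (mul_le_of_le_one_right (norm_nonneg _) ?_).trans (hb y (Set.Ico_subset_Icc_self hy))
  exact Real.abs_sin_le_one _

lemma oscillator_forward {w w1 h : ℝ → ℂ} {β β' : ℝ → ℝ} {p t : ℝ} (hpt : p ≤ t)
    (hw : ∀ y ∈ Set.Icc p t, HasDerivAt w (w1 y) y)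
    (hw1 : ∀ y ∈ Set.Icc p t, HasDerivAt w1 (-w y + h y) y)
    (hβ : ∀ y ∈ Set.Icc p t, HasDerivAt β (β' y) y)
    (hb : ∀ y ∈ Set.Icc p t, ‖h y‖ ≤ β' y) :
    ‖w t‖ ≤ ‖w p‖ + ‖w1 p‖ + (β t - β p) := by
  have h1 := oscillator_step hpt hw hw1 hβ hb t
  have h2 : ‖w p * Real.cos (p - t) - w1 p * Real.sin (p - t)‖ ≤ ‖w p‖ + ‖w1 p‖ := by
    refine (norm_sub_le _ _).trans ?_
    rw [norm_mul, norm_mul, Complex.norm_real, Complex.norm_real]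
    exact add_le_add (mul_le_of_le_one_right (norm_nonneg _) (Real.abs_cos_le_one _))
      (mul_le_of_le_one_right (norm_nonneg _) (Real.abs_sin_le_one _))
  simp only [sub_self, Real.cos_zero, Real.sin_zero, Complex.ofReal_one, Complex.ofReal_zero,
    mul_one, mul_zero, sub_zero] at h1
  have h3 := norm_sub_norm_le (w t) (w p * Real.cos (p - t) - w1 p * Real.sin (p - t))
  linarith

lemma oscillator_backward {w w1 h : ℝ → ℂ} {β β' : ℝ → ℝ} {p : ℝ}
    (hw : ∀ y, p ≤ y → HasDerivAt w (w1 y) y)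
    (hw1 : ∀ y, p ≤ y → HasDerivAt w1 (-w y + h y) y)
    (hβ : ∀ y, p ≤ y → HasDerivAt β (β' y) y)
    (hb : ∀ y, p ≤ y → ‖h y‖ ≤ β' y) (hβ0 : ∀ y, p ≤ y → β y ≤ 0)
    (hlim : Tendsto w atTop (𝓝 0)) : ‖w p‖ ≤ -β p := by
  have hb' : ∀ n : ℕ, ‖w p‖ ≤ ‖w (p + n * π)‖ - β p := by
    intro n
    have hpt : p ≤ p + n * π := by have := Real.pi_pos; nlinarith [(Nat.cast_nonneg n : (0 : ℝ) ≤ n)]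
    have h1 := oscillator_step hpt (fun y hy => hw y hy.1) (fun y hy => hw1 y hy.1)
      (fun y hy => hβ y hy.1) (fun y hy => hb y hy.1) p
    simp only [add_sub_cancel_left, sub_self, Real.cos_zero, Real.sin_zero, Real.sin_nat_mul_pi,
      Complex.ofReal_one, Complex.ofReal_zero, mul_one, mul_zero, sub_zero] at h1
    have h2 := norm_sub_norm_le (w p) (w (p + n * π) * Real.cos (n * π))
    rw [norm_sub_rev] at h2
    have h3 : ‖w (p + n * π) * Real.cos (n * π)‖ ≤ ‖w (p + n * π)‖ := by
      rw [norm_mul, Complex.norm_real]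
      exact mul_le_of_le_one_right (norm_nonneg _) (Real.abs_cos_le_one _)
    have := hβ0 _ hpt
    linarith
  have hl : Tendsto (fun n : ℕ => ‖w (p + n * π)‖ - β p) atTop (𝓝 (0 - β p)) := by
    refine Tendsto.sub_const ?_ _
    have : Tendsto (fun n : ℕ => p + n * π) atTop atTop :=
      tendsto_atTop_add_const_left _ _ (tendsto_natCast_atTop_atTop.atTop_mul_const Real.pi_pos)
    simpa using (hlim.comp this).norm
  have := ge_of_tendsto' hl hb'
  linarith

lemma norm_smul_ray {σ s : ℝ} (hσ : σ ^ 2 = 1) (hs : 0 ≤ s) (u : V3) :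
    ‖(σ * s) • u‖ = s * ‖u‖ ∧ |σ * s * om u| = s * om u := by
  have h1 : |σ| = 1 := by rw [← sq_eq_sq₀ (abs_nonneg _) zero_le_one, sq_abs, hσ, one_pow]
  constructor
  · rw [norm_smul, norm_mul, Real.norm_eq_abs, h1, one_mul, Real.norm_of_nonneg hs]
  · rw [abs_mul, abs_mul, h1, abs_of_nonneg hs, abs_of_pos (om_pos u), one_mul]

lemma ray_sq {σ : ℝ} (hσ : σ ^ 2 = 1) (s : ℝ) (u : V3) :
    (σ * s * om u) ^ 2 - ‖(σ * s) • u‖ ^ 2 = s ^ 2 := by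
  rw [norm_smul, Real.norm_eq_abs, mul_pow |σ * s|, sq_abs]
  linear_combination (σ ^ 2 * s ^ 2) * om_sq_sub u + s ^ 2 * hσ

/-- A crude a priori bound, growing in `s` but decaying rapidly in `u`. -/
lemma wv_apriori {c : ℝ} (hc : 0 < c) (M : ℕ) (g : 𝓢(V3, ℂ)) : ∃ C, 0 ≤ C ∧
    ∀ (σ s : ℝ) (u : V3), σ ^ 2 = 1 → c ≤ s →
      om u ^ M * ‖wv σ u g s‖ ≤ C * s ^ ((M + 1 : ℕ) + 1 / 2 : ℝ) := by
  obtain ⟨C, hC, h⟩ := Wf_timelike M g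
  refine ⟨C * ((c ^ 2)⁻¹ + 1) ^ M, by positivity, fun σ s u hσ hs => ?_⟩
  have hs0 : 0 < s := hc.trans_le hs
  obtain ⟨e1, e2⟩ := norm_smul_ray hσ hs0.le u
  have h1 := h (σ * s * om u) ((σ * s) • u)
    (by rw [e1, e2]; exact mul_le_mul_of_nonneg_left (norm_le_om u) hs0.le)
  rw [ray_sq hσ, e2] at h1
  have h2 : 1 + s ^ 2 ≤ ((c ^ 2)⁻¹ + 1) * s ^ 2 := by
    have : 1 ≤ (c ^ 2)⁻¹ * s ^ 2 := by
      rw [inv_mul_eq_div, one_le_div (by positivity)]; gcongr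
    linarith
  have h3 : om u ^ M * ‖Wray σ u g s‖ ≤ C * ((c ^ 2)⁻¹ + 1) ^ M * s ^ M := by
    refine le_of_mul_le_mul_left ?_ (pow_pos hs0 M)
    calc s ^ M * (om u ^ M * ‖Wray σ u g s‖) = (s * om u) ^ M * ‖Wray σ u g s‖ := by ring
      _ ≤ C * (1 + s ^ 2) ^ M := h1
      _ ≤ C * (((c ^ 2)⁻¹ + 1) * s ^ 2) ^ M := by gcongr
      _ = s ^ M * (C * ((c ^ 2)⁻¹ + 1) ^ M * s ^ M) := by rw [mul_pow, ← pow_mul]; ring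
  have h4 : s ^ ((M + 1 : ℕ) + 1 / 2 : ℝ) = s ^ M * s ^ (3 / 2 : ℝ) := by
    rw [← Real.rpow_natCast s M, ← Real.rpow_add hs0]; congr 1; push_cast; ring
  rw [wv, norm_mul, Complex.norm_real, Real.norm_of_nonneg (by positivity), h4]
  calc om u ^ M * (s ^ (3 / 2 : ℝ) * ‖Wray σ u g s‖)
      = s ^ (3 / 2 : ℝ) * (om u ^ M * ‖Wray σ u g s‖) := by ring
    _ ≤ s ^ (3 / 2 : ℝ) * (C * ((c ^ 2)⁻¹ + 1) ^ M * s ^ M) := by gcongr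
    _ = _ := by ring

lemma wv_Cx_le (σ s : ℝ) (u : V3) (g : 𝓢(V3, ℂ)) :
    ‖wv σ u (Cx (om u) u g) s‖ ≤ om u * (‖wv σ u (Om g) s‖ + ∑ j, ‖wv σ u (Qm j g) s‖) := by
  have e : wv σ u (Cx (om u) u g) s = om u * wv σ u (Om g) s - ∑ j, u j * wv σ u (Qm j g) s := by
    simp only [wv, Wray, Cx, LinearMap.sub_apply, LinearMap.smul_apply, LinearMap.sum_apply,
      map_sub, map_sum, map_smul, smul_eq_mul, mul_sub, Finset.mul_sum]
    congr 1
    · ring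
    · exact Finset.sum_congr rfl fun j _ => by ring
  rw [e, mul_add, Finset.mul_sum]
  refine (norm_sub_le _ _).trans (add_le_add ?_ (norm_sum_le_of_le _ fun j _ => ?_))
  · rw [norm_mul, Complex.norm_real, Real.norm_of_nonneg (om_pos u).le]
  · rw [norm_mul, Complex.norm_real]
    gcongr
    exact (abs_coord_le u j).trans (norm_le_om u)

lemma initial_data {c : ℝ} (hc : 0 < c) (M : ℕ) (g : 𝓢(V3, ℂ)) : ∃ C, 0 ≤ C ∧
    ∀ (σ : ℝ) (u : V3), σ ^ 2 = 1 → om u ^ M * (‖wv σ u g c‖ + ‖wd σ u g c‖) ≤ C := by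
  choose C hC0 hC using fun M g => wv_apriori hc M g
  set K := c ^ (((M + 1) + 1 : ℕ) + 1 / 2 : ℝ) with hK
  set K' := c ^ ((M + 1 : ℕ) + 1 / 2 : ℝ) with hK'
  have hKp : 0 ≤ K := by positivity
  have hKp' : 0 ≤ K' := by positivity
  refine ⟨C M g * K' + ((C (M + 1) (Om g) * K + ∑ j, C (M + 1) (Qm j g) * K)
      + 3 / 2 * c⁻¹ * (C M g * K')), ?_, fun σ u hσ => ?_⟩
  · have := hC0 M g
    have := hC0 (M + 1) (Om g)
    have : 0 ≤ ∑ j, C (M + 1) (Qm j g) * K :=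
      Finset.sum_nonneg fun j _ => mul_nonneg (hC0 _ _) hKp
    positivity
  have hu := om_pos u
  have hσ1 : ‖(σ : ℂ)‖ = 1 := by
    rw [Complex.norm_real, Real.norm_eq_abs, ← sq_eq_sq₀ (abs_nonneg _) zero_le_one, sq_abs, hσ, one_pow]
  have hwd : ‖wd σ u g c‖ ≤ om u * (‖wv σ u (Om g) c‖ + ∑ j, ‖wv σ u (Qm j g) c‖)
      + 3 / 2 * c⁻¹ * ‖wv σ u g c‖ := by
    rw [wd]
    refine (norm_add_le _ _).trans (add_le_add ?_ ?_)
    · rw [norm_mul, norm_mul, hσ1, norm_neg, Complex.norm_I, one_mul, one_mul]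
      exact wv_Cx_le ..
    · rw [norm_mul, norm_mul, norm_inv, Complex.norm_real, Real.norm_of_nonneg hc.le]
      norm_num
  calc om u ^ M * (‖wv σ u g c‖ + ‖wd σ u g c‖)
      ≤ om u ^ M * (‖wv σ u g c‖ + (om u * (‖wv σ u (Om g) c‖ + ∑ j, ‖wv σ u (Qm j g) c‖)
      + 3 / 2 * c⁻¹ * ‖wv σ u g c‖)) := by gcongr
    _ = om u ^ M * ‖wv σ u g c‖ + ((om u ^ (M + 1) * ‖wv σ u (Om g) c‖
        + ∑ j, om u ^ (M + 1) * ‖wv σ u (Qm j g) c‖)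
        + 3 / 2 * c⁻¹ * (om u ^ M * ‖wv σ u g c‖)) := by rw [← Finset.mul_sum]; ring
    _ ≤ _ := by
      have hM := hC M g σ c u hσ le_rfl
      refine add_le_add hM (add_le_add (add_le_add (hC _ _ σ c u hσ le_rfl)
        (Finset.sum_le_sum fun j _ => hC _ _ σ c u hσ le_rfl)) ?_)
      gcongr

lemma wv_forward {c : ℝ} (hc : 0 < c) {σ : ℝ} (hσ : σ ^ 2 = 1) (M : ℕ) (u : V3) (g : 𝓢(V3, ℂ))
    {C e s : ℝ} (he : e - 1 ≠ 0) (hs : c ≤ s)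
    (hb : ∀ y, c ≤ y → om u ^ M * ‖wv σ u (Aop g) y‖ ≤ C * y ^ e) :
    om u ^ M * ‖wv σ u g s‖ ≤ om u ^ M * (‖wv σ u g c‖ + ‖wd σ u g c‖)
      + C / (e - 1) * (s ^ (e - 1) - c ^ (e - 1)) := by
  have hu : 0 < om u ^ M := pow_pos (om_pos u) M
  have h := oscillator_forward (w := wv σ u g) (w1 := wd σ u g)
    (h := fun s => ((s ^ 2 : ℝ) : ℂ)⁻¹ * wv σ u (Aop g) s)
    (β := fun s => (om u ^ M)⁻¹ * (C / (e - 1) * s ^ (e - 1)))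
    (β' := fun s => (om u ^ M)⁻¹ * (C / (e - 1) * ((e - 1) * s ^ (e - 1 - 1)))) hs
    (fun y hy => hasDerivAt_wv σ u g (hc.trans_le hy.1))
    (fun y hy => hasDerivAt_wd hσ u g (hc.trans_le hy.1))
    (fun y hy => ((Real.hasDerivAt_rpow_const (Or.inl (hc.trans_le hy.1).ne')).const_mul _).const_mul _)
    (fun y hy => ?_)
  · calc om u ^ M * ‖wv σ u g s‖ ≤ om u ^ M * (‖wv σ u g c‖ + ‖wd σ u g c‖
          + ((om u ^ M)⁻¹ * (C / (e - 1) * s ^ (e - 1))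
            - (om u ^ M)⁻¹ * (C / (e - 1) * c ^ (e - 1)))) := by gcongr
      _ = _ := by field_simp
  · have hy0 : 0 < y := hc.trans_le hy.1
    have h1 := hb y hy.1
    rw [norm_mul, norm_inv, Complex.norm_real, Real.norm_of_nonneg (by positivity), le_inv_mul_iff₀ hu]
    calc om u ^ M * ((y ^ 2)⁻¹ * ‖wv σ u (Aop g) y‖)
        = (y ^ 2)⁻¹ * (om u ^ M * ‖wv σ u (Aop g) y‖) := by ring
      _ ≤ (y ^ 2)⁻¹ * (C * y ^ e) := by gcongr
      _ = C / (e - 1) * ((e - 1) * y ^ (e - 1 - 1)) := by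
        rw [show e - 1 - 1 = e - 2 by ring, Real.rpow_sub hy0, Real.rpow_two]
        field_simp

/-- The amplitude is bounded along rays, uniformly and rapidly decaying in the velocity. -/
lemma wv_bounded {c : ℝ} (hc : 0 < c) (M : ℕ) (g : 𝓢(V3, ℂ)) : ∃ C, 0 ≤ C ∧
    ∀ (σ s : ℝ) (u : V3), σ ^ 2 = 1 → c ≤ s → om u ^ M * ‖wv σ u g s‖ ≤ C := by
  suffices H : ∀ n : ℕ, (∀ g : 𝓢(V3, ℂ), ∃ C, 0 ≤ C ∧ ∀ (σ s : ℝ) (u : V3), σ ^ 2 = 1 → c ≤ s →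
      om u ^ M * ‖wv σ u g s‖ ≤ C * s ^ (n + 1 / 2 : ℝ)) → ∀ g : 𝓢(V3, ℂ), ∃ C, 0 ≤ C ∧
      ∀ (σ s : ℝ) (u : V3), σ ^ 2 = 1 → c ≤ s → om u ^ M * ‖wv σ u g s‖ ≤ C from
    H (M + 1) (wv_apriori hc M) g
  intro n
  induction n with
  | zero =>
    intro h g
    obtain ⟨C, hC, hb⟩ := h (Aop g)
    obtain ⟨D, hD, hd⟩ := initial_data hc M g
    refine ⟨D + 2 * C * c ^ (-(1 / 2) : ℝ), by positivity, fun σ s u hσ hs => ?_⟩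
    have hs0 : 0 < s := hc.trans_le hs
    have h1 := wv_forward hc hσ M u g (C := C) (e := 1 / 2) (by norm_num) hs
      (fun y hy => by simpa using hb σ y u hσ hy)
    have h2 := hd σ u hσ
    norm_num at h1
    have h3 : 0 ≤ C * s ^ (-(1 / 2) : ℝ) := by positivity
    norm_num at h3 ⊢
    linarith
  | succ n ih =>
    intro h
    refine ih fun g => ?_
    obtain ⟨C, hC, hb⟩ := h (Aop g)
    obtain ⟨D, hD, hd⟩ := initial_data hc M g
    have hcp : 0 < c ^ (n + 1 / 2 : ℝ) := by positivity
    refine ⟨D / c ^ (n + 1 / 2 : ℝ) + C / (n + 1 / 2), by positivity, fun σ s u hσ hs => ?_⟩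
    have hs0 : 0 < s := hc.trans_le hs
    have he : ((n + 1 : ℕ) + 1 / 2 : ℝ) - 1 = n + 1 / 2 := by push_cast; ring
    have h1 := wv_forward hc hσ M u g (C := C) (e := (n + 1 : ℕ) + 1 / 2)
      (by rw [he]; positivity) hs (fun y hy => hb σ y u hσ hy)
    rw [he] at h1
    have h2 := hd σ u hσ
    have h4 : c ^ (n + 1 / 2 : ℝ) ≤ s ^ (n + 1 / 2 : ℝ) := by gcongr
    have h3 : D ≤ D / c ^ (n + 1 / 2 : ℝ) * s ^ (n + 1 / 2 : ℝ) := by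
      rw [div_mul_eq_mul_div, le_div_iff₀ hcp]; gcongr
    have h5 : C / (n + 1 / 2) * (s ^ (n + 1 / 2 : ℝ) - c ^ (n + 1 / 2 : ℝ))
        ≤ C / (n + 1 / 2) * s ^ (n + 1 / 2 : ℝ) := by
      gcongr; linarith
    rw [add_mul]
    linarith

/-! ### Lorentz boosts and the Morse coordinate -/

lemma integral_comp_bijective {f : V3 → V3} {f' : V3 → V3 →L[ℝ] V3} (hf : Function.Bijective f)
    (hf' : ∀ q, HasFDerivAt f (f' q) q) (g : V3 → ℂ) :
    ∫ p, g p = ∫ q, ((|(f' q).det| : ℝ) : ℂ) * g (f q) := by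
  have h := integral_image_eq_integral_abs_det_fderiv_smul (μ := volume) (s := Set.univ) MeasurableSet.univ
    (fun q _ => (hf' q).hasFDerivWithinAt) hf.1.injOn g
  rw [Set.image_univ, hf.2.range_eq, setIntegral_univ, setIntegral_univ] at h
  simpa using h

lemma det_id_add_smulRight (L : V3 →L[ℝ] ℝ) (v : V3) :
    (ContinuousLinearMap.id ℝ V3 + L.smulRight v).det = 1 + L v := by
  have := LinearMap.transvection.det (L : V3 →ₗ[ℝ] ℝ) v
  rw [← ContinuousLinearMap.coe_coe L, ← this]
  rfl

/-- The Lorentz boost taking the origin of the mass shell to `u`. -/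
def boost (u q : V3) : V3 := q + (om q + (1 + om u)⁻¹ * ⟪u, q⟫_ℝ) • u

lemma one_add_om_ne (u : V3) : 1 + om u ≠ 0 := by have := om_pos u; positivity

lemma om_boost (u q : V3) : om (boost u q) = om u * om q + ⟪u, q⟫_ℝ := by
  have h1 : |⟪u, q⟫_ℝ| ≤ om u * om q :=
    (abs_real_inner_le_norm u q).trans
      (mul_le_mul (norm_le_om u) (norm_le_om q) (norm_nonneg _) (om_pos u).le)
  have h2 : 0 ≤ om u * om q + ⟪u, q⟫_ℝ := by linarith [neg_abs_le ⟪u, q⟫_ℝ]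
  rw [← sq_eq_sq₀ (om_pos _).le h2, om_sq, boost, norm_add_sq_real, inner_smul_right, norm_smul,
    Real.norm_eq_abs, mul_pow, sq_abs, real_inner_comm q u]
  have hu := om_sq u
  have hq := om_sq q
  have h0 := one_add_om_ne u
  have : ‖u‖ ^ 2 = (om u - 1) * (1 + om u) := by linear_combination -hu
  have hq' : ‖q‖ ^ 2 = om q ^ 2 - 1 := by linear_combination -hq
  rw [this, hq']
  field_simp
  ring

lemma inner_boost (u q : V3) :
    ⟪u, boost u q⟫_ℝ = om u * ⟪u, q⟫_ℝ + (om u ^ 2 - 1) * om q := by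
  rw [boost, inner_add_right, inner_smul_right, real_inner_self_eq_norm_sq]
  have hu := om_sq u
  have h0 := one_add_om_ne u
  have : ‖u‖ ^ 2 = (om u - 1) * (1 + om u) := by linear_combination -hu
  rw [this]
  field_simp
  ring

lemma om_neg (u : V3) : om (-u) = om u := by simp [om]

lemma boost_neg_boost (u q : V3) : boost (-u) (boost u q) = q := by
  rw [boost, om_neg, inner_neg_left, inner_boost, om_boost]
  conv_lhs => rw [boost]
  rw [smul_neg, add_assoc, ← sub_eq_add_neg, ← sub_smul]
  have h0 := one_add_om_ne u
  have : om q + (1 + om u)⁻¹ * ⟪u, q⟫_ℝ - (om u * om q + ⟪u, q⟫_ℝ +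
      (1 + om u)⁻¹ * -(om u * ⟪u, q⟫_ℝ + (om u ^ 2 - 1) * om q)) = 0 := by
    field_simp
    ring
  rw [this, zero_smul, add_zero]

lemma boost_bijective (u : V3) : Function.Bijective (boost u) :=
  ⟨Function.LeftInverse.injective (boost_neg_boost u),
   Function.RightInverse.surjective (g := boost (-u)) fun q => by
    simpa using boost_neg_boost (-u) q⟩

lemma hasFDerivAt_boost (u q : V3) : HasFDerivAt (boost u)
    (ContinuousLinearMap.id ℝ V3 +
      ((om q)⁻¹ • innerSL ℝ q + (1 + om u)⁻¹ • innerSL ℝ u).smulRight u) q := by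
  have h1 : HasFDerivAt (fun q => om q + (1 + om u)⁻¹ * ⟪u, q⟫_ℝ)
      ((om q)⁻¹ • innerSL ℝ q + (1 + om u)⁻¹ • innerSL ℝ u) q :=
    (hasFDerivAt_om q).add ((innerSL ℝ u).hasFDerivAt.const_mul _)
  exact (hasFDerivAt_id q).add (h1.smul_const u)

lemma det_boost (u q : V3) : (ContinuousLinearMap.id ℝ V3 +
      ((om q)⁻¹ • innerSL ℝ q + (1 + om u)⁻¹ • innerSL ℝ u).smulRight u).det
      = om (boost u q) * (om q)⁻¹ := by
  rw [det_id_add_smulRight, om_boost]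
  simp only [add_apply, smul_apply, innerSL_apply_apply,
    real_inner_self_eq_norm_sq, smul_eq_mul, real_inner_comm q u]
  have hu := om_sq u
  have h0 := one_add_om_ne u
  have hq := (om_pos q).ne'
  have : ‖u‖ ^ 2 = (om u - 1) * (1 + om u) := by linear_combination -hu
  rw [this]
  field_simp
  ring

lemma Wray_boost (σ : ℝ) (u : V3) (g : 𝓢(V3, ℂ)) (s : ℝ) :
    Wray σ u g s = ∫ q, (om q : ℂ)⁻¹ * g (boost u q) * Complex.exp (-(Complex.I * σ * s * om q)) := by
  rw [Wray, Wf_def, integral_comp_bijective (boost_bijective u) (hasFDerivAt_boost u)]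
  refine integral_congr_ae (Filter.Eventually.of_forall fun q => ?_)
  simp only [det_boost, ph_ray, Oi_apply]
  rw [abs_of_pos (mul_pos (om_pos _) (inv_pos.2 (om_pos _)))]
  have h1 := om_ne (boost u q)
  have h2 : om u * om (boost u q) - ⟪u, boost u q⟫_ℝ = om q := by
    rw [inner_boost, om_boost]; ring
  rw [h2]
  push_cast
  field_simp

/-- The factor `(1 + |y|²/4)^{1/2}`. -/
def mf (y : V3) : ℝ := om ((1 / 2 : ℝ) • y)

/-- The inverse Morse coordinate, for which `ω = 1 + |y|²/2`. -/
def morse (y : V3) : V3 := mf y • y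

lemma mf_sq (y : V3) : mf y ^ 2 = 1 + ‖y‖ ^ 2 / 4 := by
  rw [mf, om_sq, norm_smul]; norm_num; ring

lemma om_morse (y : V3) : om (morse y) = 1 + ‖y‖ ^ 2 / 2 := by
  rw [← sq_eq_sq₀ (om_pos _).le (by positivity), om_sq, morse, norm_smul, mul_pow, Real.norm_eq_abs,
    sq_abs, mf_sq]
  ring

lemma hasFDerivAt_mf (y : V3) : HasFDerivAt mf ((4 * mf y)⁻¹ • innerSL ℝ y) y := by
  have h := (hasFDerivAt_om ((1 / 2 : ℝ) • y)).comp y ((hasFDerivAt_id y).const_smul (1 / 2 : ℝ))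
  refine h.congr_fderiv ?_
  ext v
  simp [mf]
  ring

lemma mf_pos (y : V3) : 0 < mf y := om_pos _

lemma hasFDerivAt_morse (y : V3) : HasFDerivAt morse
    (mf y • (ContinuousLinearMap.id ℝ V3 + ((4 * mf y ^ 2)⁻¹ • innerSL ℝ y).smulRight y)) y := by
  refine ((hasFDerivAt_mf y).smul (hasFDerivAt_id y)).congr_fderiv ?_
  have := (mf_pos y).ne'
  ext1 v
  simp only [add_apply, smul_apply,
    ContinuousLinearMap.smulRight_apply, innerSL_apply_apply, smul_eq_mul, smul_add, smul_smul,
    ContinuousLinearMap.id_apply, id]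
  congr 2
  field_simp

lemma det_morse (y : V3) :
    (mf y • (ContinuousLinearMap.id ℝ V3 + ((4 * mf y ^ 2)⁻¹ • innerSL ℝ y).smulRight y)).det
      = mf y * om (morse y) := by
  have h : (mf y • (ContinuousLinearMap.id ℝ V3 + ((4 * mf y ^ 2)⁻¹ • innerSL ℝ y).smulRight y)).det
      = mf y ^ 3 * (ContinuousLinearMap.id ℝ V3 + ((4 * mf y ^ 2)⁻¹ • innerSL ℝ y).smulRight y).det := by
    rw [ContinuousLinearMap.det, ContinuousLinearMap.toLinearMap_smul, LinearMap.det_smul]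
    simp [ContinuousLinearMap.det]
  rw [h, det_id_add_smulRight, om_morse]
  simp only [smul_apply, innerSL_apply_apply, real_inner_self_eq_norm_sq, smul_eq_mul]
  have h0 := (mf_pos y).ne'
  have h1 : ‖y‖ ^ 2 = 4 * (mf y ^ 2 - 1) := by rw [mf_sq]; ring
  rw [h1]
  field_simp
  ring

lemma norm_sq_of_morse (y : V3) : mf y ^ 2 = (1 + om (morse y)) / 2 := by
  rw [om_morse, mf_sq]; ring

lemma morse_bijective : Function.Bijective morse := by
  constructor
  · intro y z h
    have h1 : mf y = mf z := by
      rw [← sq_eq_sq₀ (mf_pos y).le (mf_pos z).le, norm_sq_of_morse, norm_sq_of_morse, h]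
    rw [morse, morse, h1] at h
    exact smul_right_injective V3 (mf_pos z).ne' h
  · intro q
    have hp : 0 < 2 / (1 + om q) := by have := om_pos q; positivity
    refine ⟨Real.sqrt (2 / (1 + om q)) • q, ?_⟩
    have hm : mf (Real.sqrt (2 / (1 + om q)) • q) = (Real.sqrt (2 / (1 + om q)))⁻¹ := by
      rw [← sq_eq_sq₀ (mf_pos _).le (by positivity), mf_sq, norm_smul, mul_pow, Real.norm_eq_abs,
        sq_abs, inv_pow, Real.sq_sqrt hp.le]
      have := one_add_om_ne q
      have h2 : ‖q‖ ^ 2 = om q ^ 2 - 1 := by rw [om_sq]; ring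
      rw [h2]
      field_simp
      ring
    rw [morse, hm, smul_smul, inv_mul_cancel₀ (Real.sqrt_pos.2 hp).ne', one_smul]

lemma Wray_morse (σ : ℝ) (u : V3) (g : 𝓢(V3, ℂ)) (s : ℝ) :
    Wray σ u g s = Complex.exp (-(Complex.I * σ * s)) *
      ∫ y, (mf y : ℂ) * g (boost u (morse y)) *
        Complex.exp (-(Complex.I * (σ * s / 2 : ℝ)) * (‖y‖ : ℂ) ^ 2) := by
  rw [Wray_boost, integral_comp_bijective morse_bijective hasFDerivAt_morse, ← integral_const_mul]
  refine integral_congr_ae (Filter.Eventually.of_forall fun y => ?_)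
  simp only [det_morse]
  rw [abs_of_pos (mul_pos (mf_pos _) (om_pos _))]
  have h1 := om_ne (morse y)
  have h2 : Complex.exp (-(Complex.I * σ * s * om (morse y))) = Complex.exp (-(Complex.I * σ * s)) *
      Complex.exp (-(Complex.I * (σ * s / 2 : ℝ)) * (‖y‖ : ℂ) ^ 2) := by
    rw [← Complex.exp_add, om_morse]
    congr 1
    push_cast
    ring
  rw [h2]
  push_cast
  field_simp

lemma mf_hasTemperateGrowth : Function.HasTemperateGrowth mf :=
  om_hasTemperateGrowth.comp ((1 / 2 : ℝ) • ContinuousLinearMap.id ℝ V3).hasTemperateGrowth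

lemma morse_hasTemperateGrowth : Function.HasTemperateGrowth morse :=
  mf_hasTemperateGrowth.smul Function.HasTemperateGrowth.id'

lemma boost_hasTemperateGrowth (u : V3) : Function.HasTemperateGrowth (boost u) :=
  Function.HasTemperateGrowth.id'.add
    ((om_hasTemperateGrowth.add ((Function.HasTemperateGrowth.const _).mul
      (Function.hasTemperateGrowth_inner_right u))).smul (Function.HasTemperateGrowth.const u))

lemma om_le_one_add_norm (q : V3) : om q ≤ 1 + ‖q‖ := by
  rw [om]; exact Real.sqrt_le_iff.2 ⟨by positivity, by nlinarith [norm_nonneg q]⟩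

lemma norm_boost_le (u q : V3) : ‖boost u q‖ ≤ (1 + ‖u‖) ^ 2 * (1 + ‖q‖) ^ 1 := by
  have h1 : ‖boost u q‖ ≤ ‖q‖ + (om q + ‖u‖ * ‖q‖) * ‖u‖ := by
    rw [boost]
    refine (norm_add_le _ _).trans (add_le_add le_rfl ?_)
    rw [norm_smul]
    gcongr
    refine (norm_add_le _ _).trans ?_
    rw [Real.norm_of_nonneg (om_pos q).le, norm_mul]
    refine add_le_add le_rfl ?_
    have h2 : ‖(1 + om u)⁻¹‖ ≤ 1 := by
      rw [Real.norm_of_nonneg (by have := om_pos u; positivity)]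
      exact inv_le_one_of_one_le₀ (by linarith [om_pos u])
    calc ‖(1 + om u)⁻¹‖ * ‖⟪u, q⟫_ℝ‖ ≤ 1 * (‖u‖ * ‖q‖) := by
          gcongr; exact abs_real_inner_le_norm u q
      _ = _ := one_mul _
  have := om_le_one_add_norm q
  nlinarith [norm_nonneg u, norm_nonneg q, mul_nonneg (norm_nonneg u) (norm_nonneg q),
    mul_le_mul_of_nonneg_right this (norm_nonneg u)]

/-- The profile `g` transported to the Morse coordinate centred at `u`. -/
def profile (u : V3) (g : 𝓢(V3, ℂ)) : 𝓢(V3, ℂ) :=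
  mulS mf (SchwartzMap.compCLM ℂ morse_hasTemperateGrowth
    ⟨1, 1, fun y => by
      have : 1 ≤ mf y := one_le_om _
      rw [morse, norm_smul, Real.norm_of_nonneg (mf_pos y).le]
      nlinarith [norm_nonneg y]⟩
    (SchwartzMap.compCLM ℂ (boost_hasTemperateGrowth u)
      ⟨1, (1 + ‖u‖) ^ 2, fun q => by
        have := norm_boost_le (-u) (boost u q)
        rwa [boost_neg_boost, norm_neg] at this⟩ g))

lemma profile_apply (u y : V3) (g : 𝓢(V3, ℂ)) :
    profile u g y = (mf y : ℂ) * g (boost u (morse y)) := by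
  rw [profile, mulS_apply mf_hasTemperateGrowth]; rfl

lemma profile_zero (u : V3) (g : 𝓢(V3, ℂ)) : profile u g 0 = g u := by
  rw [profile_apply]; simp [mf, om, boost, morse]

lemma norm_gauss_le {b : ℂ} (hb : 0 ≤ b.re) (y : V3) :
    ‖Complex.exp (-b * (‖y‖ : ℂ) ^ 2)‖ ≤ 1 := by
  rw [Complex.norm_exp, Real.exp_le_one_iff, ← Complex.ofReal_pow, Complex.re_mul_ofReal,
    Complex.neg_re]
  nlinarith [sq_nonneg ‖y‖]

lemma tendsto_integral_gauss {ι : Type*} {l : Filter ι} [l.IsCountablyGenerated] (F : 𝓢(V3, ℂ))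
    {β : ι → ℂ} {b : ℂ} (hβ : ∀ᶠ i in l, 0 ≤ (β i).re) (hl : Tendsto β l (𝓝 b)) :
    Tendsto (fun i => ∫ y, F y * Complex.exp (-β i * (‖y‖ : ℂ) ^ 2)) l
      (𝓝 (∫ y, F y * Complex.exp (-b * (‖y‖ : ℂ) ^ 2))) := by
  refine tendsto_integral_filter_of_dominated_convergence (fun y => ‖F y‖) ?_ ?_
    F.integrable.norm ?_
  · refine Eventually.of_forall fun i => Continuous.aestronglyMeasurable ?_
    have := F.continuous
    fun_prop
  · filter_upwards [hβ] with i hi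
    refine Eventually.of_forall fun y => ?_
    rw [norm_mul]
    exact mul_le_of_le_one_right (norm_nonneg _) (norm_gauss_le hi y)
  · refine Eventually.of_forall fun y => ?_
    exact ((Complex.continuous_exp.tendsto _).comp (hl.neg.mul_const _)).const_mul _

lemma integral_gauss_of_pos (F : 𝓢(V3, ℂ)) {b : ℂ} (hb : 0 < b.re) :
    ∫ y, (𝓕 F) y * Complex.exp (-b * (‖y‖ : ℂ) ^ 2) =
      (π / b) ^ (3 / 2 : ℂ) * ∫ ξ, F ξ * Complex.exp (-((π : ℂ) ^ 2 / b) * (‖ξ‖ : ℂ) ^ 2) := by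
  have J : Integrable (fun w : V3 => Complex.exp (-b * (‖w‖ : ℂ) ^ 2)) := by
    simpa using GaussianFourier.integrable_cexp_neg_mul_sq_norm_add hb 0 (0 : V3)
  have h : ∫ y, (𝓕 F) y * Complex.exp (-b * (‖y‖ : ℂ) ^ 2) =
      ∫ ξ, F ξ * 𝓕 (fun w : V3 => Complex.exp (-b * (‖w‖ : ℂ) ^ 2)) ξ := by
    simpa using! VectorFourier.integral_bilin_fourierIntegral_eq_flip
      (ContinuousLinearMap.mul ℂ ℂ) (L := innerₗ V3)
      continuous_fourierChar continuous_inner F.integrable J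
  rw [h, ← integral_const_mul]
  congr 1 with ξ
  rw [fourier_gaussian_innerProductSpace hb]
  simp only [finrank_euclideanSpace, Fintype.card_fin]
  rw [show (-(π : ℂ) ^ 2 * (‖ξ‖ : ℂ) ^ 2 / b) = -((π : ℂ) ^ 2 / b) * (‖ξ‖ : ℂ) ^ 2 by ring]
  push_cast
  ring

lemma re_div_nonneg {b : ℂ} (hb : 0 ≤ b.re) {r : ℝ} (hr : 0 ≤ r) : 0 ≤ ((r : ℂ) / b).re := by
  rw [Complex.div_re]
  simp only [Complex.ofReal_re, Complex.ofReal_im, zero_mul, zero_div, add_zero]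
  have := Complex.normSq_nonneg b
  positivity

lemma integral_gauss (F : 𝓢(V3, ℂ)) {b : ℂ} (hb : 0 ≤ b.re) (hb0 : b ≠ 0) :
    ∫ y, (𝓕 F) y * Complex.exp (-b * (‖y‖ : ℂ) ^ 2) =
      (π / b) ^ (3 / 2 : ℂ) * ∫ ξ, F ξ * Complex.exp (-((π : ℂ) ^ 2 / b) * (‖ξ‖ : ℂ) ^ 2) := by
  have hl : Tendsto (fun ε : ℝ => b + (ε : ℂ)) (𝓝[>] 0) (𝓝 b) := by
    have : Tendsto (fun ε : ℝ => b + (ε : ℂ)) (𝓝 0) (𝓝 (b + ((0 : ℝ) : ℂ))) :=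
      (Continuous.tendsto (by fun_prop) _)
    simpa using this.mono_left nhdsWithin_le_nhds
  have hpos : ∀ᶠ ε : ℝ in 𝓝[>] 0, 0 < (b + (ε : ℂ)).re := by
    filter_upwards [self_mem_nhdsWithin] with ε hε
    simp only [Complex.add_re, Complex.ofReal_re]
    exact add_pos_of_nonneg_of_pos hb hε
  have h1 := tendsto_integral_gauss (𝓕 F) (hpos.mono fun _ h => h.le) hl
  have hslit : (π : ℂ) / b ∈ slitPlane := by
    have h2 := re_div_nonneg hb pi_pos.le
    rw [Complex.mem_slitPlane_iff]
    by_contra! h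
    have h3 : ((π : ℂ) / b) = 0 := Complex.ext (le_antisymm h.1 h2) h.2
    rw [div_eq_zero_iff] at h3
    exact h3.elim (by exact_mod_cast pi_ne_zero) hb0
  have h2 : Tendsto (fun ε : ℝ => ((π : ℂ) / (b + (ε : ℂ))) ^ (3 / 2 : ℂ)) (𝓝[>] 0)
      (𝓝 (((π : ℂ) / b) ^ (3 / 2 : ℂ))) :=
    (tendsto_const_nhds.div hl hb0).cpow tendsto_const_nhds hslit
  have h3 := tendsto_integral_gauss (l := 𝓝[>] (0 : ℝ)) F
    (β := fun ε : ℝ => (π : ℂ) ^ 2 / (b + (ε : ℂ)))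
    (hpos.mono fun ε h => by
      have := re_div_nonneg h.le (sq_nonneg π)
      push_cast at this
      exact this)
    (tendsto_const_nhds.div hl hb0)
  refine tendsto_nhds_unique h1 ((h2.mul h3).congr' ?_)
  filter_upwards [hpos] with ε hε
  exact (integral_gauss_of_pos F hε).symm

lemma integral_fourierInv (G : 𝓢(V3, ℂ)) : ∫ ξ, (𝓕⁻ G) ξ = G 0 := by
  have h : 𝓕 (𝓕⁻ G) = G := FourierTransform.fourier_fourierInv_eq G
  conv_rhs => rw [← h]
  rw [SchwartzMap.fourier_coe, Real.fourier_eq]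
  simp

lemma cpow_phase {σ s : ℝ} (hσ : σ = 1 ∨ σ = -1) (hs : 0 < s) :
    ((s ^ (3 / 2 : ℝ) : ℝ) : ℂ) * ((π : ℂ) / (Complex.I * (σ * s / 2 : ℝ))) ^ (3 / 2 : ℂ) =
      (((2 * π) ^ (3 / 2 : ℝ) : ℝ) : ℂ) * Complex.exp (-(Complex.I * σ * (3 * π / 4))) := by
  have hlog : Complex.log (-(σ : ℂ) * Complex.I) = -(σ : ℂ) * (π / 2) * Complex.I := by
    rcases hσ with rfl | rfl
    · simp [Complex.log_neg_I]
    · simp [Complex.log_I]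
  have hσ2 : (σ : ℂ) ^ 2 = 1 := by rcases hσ with rfl | rfl <;> simp
  have hσ0 : (σ : ℂ) ≠ 0 := by rcases hσ with rfl | rfl <;> simp
  have hs0 : (s : ℂ) ≠ 0 := by exact_mod_cast hs.ne'
  have h1 : (π : ℂ) / (Complex.I * (σ * s / 2 : ℝ)) =
      ((2 * π / s : ℝ) : ℂ) * (-(σ : ℂ) * Complex.I) := by
    push_cast
    field_simp
    rw [hσ2, Complex.I_sq]; ring
  have hz : -(σ : ℂ) * Complex.I ≠ 0 := mul_ne_zero (neg_ne_zero.2 hσ0) Complex.I_ne_zero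
  have hp : 0 < 2 * π / s := by positivity
  rw [h1, Complex.cpow_def_of_ne_zero (mul_ne_zero (by exact_mod_cast hp.ne') hz),
    Complex.log_ofReal_mul hp hz, hlog, add_mul, Complex.exp_add, ← mul_assoc]
  congr 1
  · rw [show ((Real.log (2 * π / s) : ℝ) : ℂ) * (3 / 2) = ((Real.log (2 * π / s) * (3 / 2) : ℝ) : ℂ)
      by push_cast; ring, ← Complex.ofReal_exp, ← Complex.ofReal_mul, ← Real.rpow_def_of_pos hp,
      ← Real.mul_rpow hs.le hp.le, mul_div_cancel₀ _ hs.ne']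
  · congr 1; ring

/-- The stationary phase constant. -/
def kst (σ : ℝ) : ℂ :=
  (((2 * π) ^ (3 / 2 : ℝ) : ℝ) : ℂ) * Complex.exp (-(Complex.I * σ * (3 * π / 4)))

lemma wv_eq_fourier {σ : ℝ} (hσ : σ = 1 ∨ σ = -1) (u : V3) (g : 𝓢(V3, ℂ)) {s : ℝ} (hs : 0 < s) :
    wv σ u g s = kst σ * Complex.exp (-(Complex.I * σ * s)) *
      ∫ ξ, (𝓕⁻ (profile u g)) ξ *
        Complex.exp (-((π : ℂ) ^ 2 / (Complex.I * (σ * s / 2 : ℝ))) * (‖ξ‖ : ℂ) ^ 2) := by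
  have hσ0 : σ ≠ 0 := by rcases hσ with rfl | rfl <;> norm_num
  have hb : 0 ≤ (Complex.I * ((σ * s / 2 : ℝ) : ℂ)).re := by
    rw [Complex.re_mul_ofReal]; simp
  have hb0 : Complex.I * ((σ * s / 2 : ℝ) : ℂ) ≠ 0 :=
    mul_ne_zero Complex.I_ne_zero (by exact_mod_cast (by positivity))
  have h := integral_gauss (𝓕⁻ (profile u g)) hb hb0
  rw [FourierTransform.fourier_fourierInv_eq] at h
  simp only [profile_apply] at h
  rw [wv, Wray_morse, h, kst, ← cpow_phase hσ hs]
  ring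

lemma tendsto_wv {σ : ℝ} (hσ : σ = 1 ∨ σ = -1) (u : V3) (g : 𝓢(V3, ℂ)) :
    Tendsto (fun s => wv σ u g s - kst σ * Complex.exp (-(Complex.I * σ * s)) * g u)
      atTop (𝓝 0) := by
  have hb : ∀ s : ℝ, 0 ≤ (Complex.I * ((σ * s / 2 : ℝ) : ℂ)).re := fun s => by
    rw [Complex.re_mul_ofReal]; simp
  have hl : Tendsto (fun s : ℝ => (π : ℂ) ^ 2 / (Complex.I * (σ * s / 2 : ℝ))) atTop (𝓝 0) := by
    have h : Tendsto (fun s : ℝ => ((s⁻¹ : ℝ) : ℂ) * ((π : ℂ) ^ 2 / (Complex.I * (σ / 2 : ℝ))))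
        atTop (𝓝 (((0 : ℝ) : ℂ) * ((π : ℂ) ^ 2 / (Complex.I * (σ / 2 : ℝ))))) :=
      ((Complex.continuous_ofReal.tendsto _).comp tendsto_inv_atTop_zero).mul_const _
    rw [Complex.ofReal_zero, zero_mul] at h
    refine h.congr fun s => ?_
    push_cast
    simp only [div_eq_mul_inv, mul_inv]
    ring
  have h := tendsto_integral_gauss (𝓕⁻ (profile u g)) (l := atTop)
    (Eventually.of_forall fun s : ℝ => by
      have := re_div_nonneg (hb s) (sq_nonneg π)
      push_cast at this ⊢
      exact this) hl
  simp only [neg_zero, zero_mul, Complex.exp_zero, mul_one, integral_fourierInv,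
    profile_zero] at h
  have h0 := tendsto_iff_norm_sub_tendsto_zero.1 h
  rw [tendsto_zero_iff_norm_tendsto_zero]
  have h2 := h0.const_mul ‖kst σ‖
  rw [mul_zero] at h2
  refine h2.congr' ?_
  filter_upwards [eventually_gt_atTop 0] with s hs
  rw [wv_eq_fourier hσ u g hs, ← mul_sub, norm_mul, norm_mul,
    show ‖Complex.exp (-(Complex.I * σ * s))‖ = 1 by
      rw [Complex.norm_exp, Real.exp_eq_one_iff, Complex.neg_re, mul_assoc,
        ← Complex.ofReal_mul, Complex.re_mul_ofReal]; simp, mul_one]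

lemma om_pow_mul_norm_le (M : ℕ) (f : 𝓢(V3, ℂ)) : ∃ C, 0 ≤ C ∧ ∀ u, om u ^ M * ‖f u‖ ≤ C := by
  refine ⟨2 ^ M * ((Finset.Iic (M, 0)).sup (schwartzSeminormFamily ℂ V3 ℂ)) f, by positivity,
    fun u => ?_⟩
  have h := SchwartzMap.one_add_le_sup_seminorm_apply (𝕜 := ℂ) (m := (M, 0)) le_rfl le_rfl f u
  rw [norm_iteratedFDeriv_zero] at h
  refine le_trans ?_ h
  have := (om_pos u).le
  gcongr
  exact om_le_one_add_norm u

/-- The operators of the asymptotic expansion. -/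
def Lop : ℕ → Module.End ℂ 𝓢(V3, ℂ)
  | 0 => 1
  | k + 1 => (1 / (2 * ((k : ℂ) + 1))) • ((Aop - ((k : ℂ) * (k + 1)) • (1 : Module.End ℂ 𝓢(V3, ℂ))) * Lop k)

lemma Lop_commute (k : ℕ) : Commute (Aop : Module.End ℂ 𝓢(V3, ℂ)) (Lop k) := by
  induction k with
  | zero => exact Commute.one_right _
  | succ k ih =>
    exact (((Commute.refl _).sub_right ((Commute.one_right _).smul_right _)).mul_right ih).smul_right _

lemma Lop_Aop (k : ℕ) (g : 𝓢(V3, ℂ)) :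
    Lop k (Aop g) = (2 * ((k : ℂ) + 1)) • Lop (k + 1) g + ((k : ℂ) * (k + 1)) • Lop k g := by
  have h : Lop k (Aop g) = Aop (Lop k g) := (LinearMap.congr_fun (Lop_commute k).eq g).symm
  have hk : (2 * ((k : ℂ) + 1)) ≠ 0 := by exact_mod_cast (by positivity : (2 * ((k : ℝ) + 1)) ≠ 0)
  rw [h, Lop, LinearMap.smul_apply, smul_smul, mul_one_div_cancel hk, one_smul, Module.End.mul_apply,
    LinearMap.sub_apply, LinearMap.smul_apply, Module.End.one_apply, sub_add_cancel]

/-- The `k`-th oscillating profile of the expansion. -/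
def Tk (σ : ℝ) (k : ℕ) (s : ℝ) : ℂ :=
  (-(Complex.I * σ)) ^ k * (Complex.exp (-(Complex.I * σ * s)) * (s : ℂ)⁻¹ ^ k)

/-- The derivative of `Tk`. -/
def Tkd (σ : ℝ) (k : ℕ) (s : ℝ) : ℂ :=
  (-(Complex.I * σ)) ^ k * (-(Complex.I * σ) * (Complex.exp (-(Complex.I * σ * s)) * (s : ℂ)⁻¹ ^ k)
    - k * (Complex.exp (-(Complex.I * σ * s)) * (s : ℂ)⁻¹ ^ (k + 1)))

lemma hasDerivAt_exp_mul_inv_pow (σ : ℝ) (k : ℕ) {s : ℝ} (hs : 0 < s) :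
    HasDerivAt (fun s : ℝ => Complex.exp (-(Complex.I * σ * s)) * (s : ℂ)⁻¹ ^ k)
      (-(Complex.I * σ) * (Complex.exp (-(Complex.I * σ * s)) * (s : ℂ)⁻¹ ^ k)
        - k * (Complex.exp (-(Complex.I * σ * s)) * (s : ℂ)⁻¹ ^ (k + 1))) s := by
  have hs' : (s : ℂ) ≠ 0 := by exact_mod_cast hs.ne'
  have h0 : HasDerivAt (fun s : ℝ => (s : ℂ)) 1 s := by
    simpa using (hasDerivAt_id s).ofReal_comp
  have h1 : HasDerivAt (fun s : ℝ => Complex.exp (-(Complex.I * σ * s)))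
      (Complex.exp (-(Complex.I * σ * s)) * -(Complex.I * σ * 1)) s :=
    ((h0.const_mul (Complex.I * σ)).neg).cexp
  have h2 : HasDerivAt (fun s : ℝ => (s : ℂ)⁻¹ ^ k)
      ((k : ℂ) * (s : ℂ)⁻¹ ^ (k - 1) * (-1 / (s : ℂ) ^ 2)) s := (h0.inv hs').pow k
  refine (h1.mul h2).congr_deriv ?_
  cases k with
  | zero => simp; ring
  | succ k =>
    simp only [Nat.add_sub_cancel, div_eq_mul_inv, ← inv_pow]
    push_cast
    ring

lemma hasDerivAt_Tk (σ : ℝ) (k : ℕ) {s : ℝ} (hs : 0 < s) : HasDerivAt (Tk σ k) (Tkd σ k s) s :=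
  (hasDerivAt_exp_mul_inv_pow σ k hs).const_mul _

lemma hasDerivAt_Tkd {σ : ℝ} (hσ : σ ^ 2 = 1) (k : ℕ) {s : ℝ} (hs : 0 < s) :
    HasDerivAt (Tkd σ k) (-Tk σ k s + ((s ^ 2 : ℝ) : ℂ)⁻¹ *
      ((k : ℂ) * (k + 1) * Tk σ k s + 2 * k * Tk σ (k - 1) s)) s := by
  have hσ' : (σ : ℂ) ^ 2 = 1 := by exact_mod_cast hσ
  have hI := Complex.I_sq
  refine ((((hasDerivAt_exp_mul_inv_pow σ k hs).const_mul _).sub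
    ((hasDerivAt_exp_mul_inv_pow σ (k + 1) hs).const_mul _)).const_mul _).congr_deriv ?_
  simp only [Tk]
  have hz : ((s ^ 2 : ℝ) : ℂ)⁻¹ = (s : ℂ)⁻¹ ^ 2 := by push_cast; rw [inv_pow]
  rw [hz]
  generalize (s : ℂ)⁻¹ = z
  generalize Complex.exp _ = E
  have hJ : (-(Complex.I * (σ : ℂ))) ^ 2 = -1 := by
    rw [neg_sq, mul_pow, hI, hσ']; ring
  generalize -(Complex.I * (σ : ℂ)) = J at *
  cases k with
  | zero =>
    simp only [Nat.cast_zero]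
    linear_combination E * hJ
  | succ k =>
    simp only [Nat.add_sub_cancel]
    push_cast
    linear_combination (J ^ (k + 1) * (E * z ^ (k + 1)) - 2 * (k + 1) * J ^ k * E * z ^ (k + 2)) * hJ

lemma norm_Tk {σ : ℝ} (hσ : σ ^ 2 = 1) (k : ℕ) {s : ℝ} (hs : 0 < s) : ‖Tk σ k s‖ = s⁻¹ ^ k := by
  have h1 : |σ| = 1 := by rw [← sq_eq_sq₀ (abs_nonneg _) zero_le_one, sq_abs, hσ, one_pow]
  have h2 : ‖Complex.exp (-(Complex.I * σ * s))‖ = 1 := by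
    rw [Complex.norm_exp, Real.exp_eq_one_iff, Complex.neg_re, mul_assoc,
      ← Complex.ofReal_mul, Complex.re_mul_ofReal]; simp
  rw [Tk, norm_mul, norm_mul, h2, norm_pow, norm_pow, norm_neg, norm_mul, Complex.norm_I,
    Complex.norm_real, norm_inv, Complex.norm_real, Real.norm_eq_abs, Real.norm_eq_abs, h1,
    abs_of_pos hs]
  simp

/-- The remainder of the expansion after `n` terms. -/
def rem (σ : ℝ) (u : V3) (n : ℕ) (g : 𝓢(V3, ℂ)) (s : ℝ) : ℂ :=
  wv σ u g s - kst σ * ∑ k ∈ Finset.range n, Tk σ k s * Lop k g u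

lemma sum_Tk_shift (T a b : ℕ → ℂ)
    (h : ∀ k, b k = 2 * ((k : ℂ) + 1) * a (k + 1) + (k : ℂ) * (k + 1) * a k) (n : ℕ) :
    ∑ k ∈ Finset.range (n + 1), ((k : ℂ) * (k + 1) * T k + 2 * k * T (k - 1)) * a k =
      ∑ k ∈ Finset.range n, T k * b k + (n : ℂ) * (n + 1) * T n * a n := by
  induction n with
  | zero => simp
  | succ n ih =>
    rw [Finset.sum_range_succ, ih, Finset.sum_range_succ, h]
    simp only [Nat.add_sub_cancel]
    push_cast
    ring

lemma hasDerivAt_rem_deriv {σ : ℝ} (hσ : σ ^ 2 = 1) (u : V3) (n : ℕ) (g : 𝓢(V3, ℂ)) {s : ℝ}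
    (hs : 0 < s) :
    HasDerivAt (fun s => wd σ u g s - kst σ * ∑ k ∈ Finset.range (n + 1), Tkd σ k s * Lop k g u)
      (-rem σ u (n + 1) g s + ((s ^ 2 : ℝ) : ℂ)⁻¹ *
        (rem σ u n (Aop g) s - kst σ * ((n : ℂ) * (n + 1) * Tk σ n s * Lop n g u))) s := by
  have h1 := (hasDerivAt_wd hσ u g hs).sub ((HasDerivAt.fun_sum (u := Finset.range (n + 1))
    fun k _ => (hasDerivAt_Tkd hσ k hs).mul_const (Lop k g u)).const_mul (kst σ))
  refine h1.congr_deriv ?_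
  have h2 := sum_Tk_shift (fun k => Tk σ k s) (fun k => Lop k g u) (fun k => Lop k (Aop g) u)
    (fun k => by simp [Lop_Aop]) n
  have h3 : ∑ k ∈ Finset.range (n + 1), (-Tk σ k s + ((s ^ 2 : ℝ) : ℂ)⁻¹ *
      ((k : ℂ) * (k + 1) * Tk σ k s + 2 * k * Tk σ (k - 1) s)) * Lop k g u =
      -∑ k ∈ Finset.range (n + 1), Tk σ k s * Lop k g u + ((s ^ 2 : ℝ) : ℂ)⁻¹ *
      ∑ k ∈ Finset.range (n + 1), ((k : ℂ) * (k + 1) * Tk σ k s + 2 * k * Tk σ (k - 1) s) * Lop k g u := by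
    rw [Finset.mul_sum, ← Finset.sum_neg_distrib, ← Finset.sum_add_distrib]
    exact Finset.sum_congr rfl fun k _ => by ring
  rw [h3, h2, rem, rem]
  ring

lemma tendsto_rem {σ : ℝ} (hσ : σ = 1 ∨ σ = -1) (u : V3) (n : ℕ) (g : 𝓢(V3, ℂ)) :
    Tendsto (rem σ u (n + 1) g) atTop (𝓝 0) := by
  have hσ2 : σ ^ 2 = 1 := by rcases hσ with rfl | rfl <;> norm_num
  have hT : ∀ k, Tendsto (Tk σ (k + 1)) atTop (𝓝 0) := fun k => by
    rw [tendsto_zero_iff_norm_tendsto_zero]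
    have h : Tendsto (fun s : ℝ => s⁻¹ ^ (k + 1)) atTop (𝓝 (0 ^ (k + 1))) :=
      tendsto_inv_atTop_zero.pow _
    rw [zero_pow (Nat.succ_ne_zero k)] at h
    refine h.congr' ?_
    filter_upwards [eventually_gt_atTop 0] with s hs
    rw [norm_Tk hσ2 _ hs]
  have h1 : Tendsto (fun s => ∑ k ∈ Finset.range n, Tk σ (k + 1) s * Lop (k + 1) g u) atTop
      (𝓝 (∑ k ∈ Finset.range n, 0 * Lop (k + 1) g u)) :=
    tendsto_finsetSum _ fun k _ => (hT k).mul_const _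
  have h2 := (tendsto_wv hσ u g).sub (h1.const_mul (kst σ))
  simp only [zero_mul, Finset.sum_const_zero, mul_zero, sub_zero] at h2
  refine h2.congr fun s => ?_
  rw [rem, Finset.sum_range_succ']
  simp only [Tk, pow_zero, Lop, Module.End.one_apply]
  ring

lemma norm_kst (σ : ℝ) : ‖kst σ‖ = (2 * π) ^ (3 / 2 : ℝ) := by
  have h2 : ‖Complex.exp (-(Complex.I * σ * (3 * π / 4)))‖ = 1 := by
    rw [Complex.norm_exp, Real.exp_eq_one_iff, Complex.neg_re, mul_assoc,
      show (σ : ℂ) * (3 * π / 4) = ((σ * (3 * π / 4) : ℝ) : ℂ) by push_cast; ring,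
      Complex.re_mul_ofReal]; simp
  rw [kst, norm_mul, h2, mul_one, Complex.norm_real, Real.norm_of_nonneg (by positivity)]

lemma rem_bound {c : ℝ} (hc : 0 < c) (M n : ℕ) (g : 𝓢(V3, ℂ)) : ∃ C, 0 ≤ C ∧
    ∀ (σ s : ℝ) (u : V3), (σ = 1 ∨ σ = -1) → c ≤ s → om u ^ M * ‖rem σ u n g s‖ ≤ C * s⁻¹ ^ n := by
  induction n generalizing g with
  | zero =>
    obtain ⟨C, hC, h⟩ := wv_bounded hc M g
    refine ⟨C, hC, fun σ s u hσ hs => ?_⟩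
    have := h σ s u (by rcases hσ with rfl | rfl <;> norm_num) hs
    simpa [rem] using this
  | succ n ih =>
    obtain ⟨C, hC, h⟩ := ih (Aop g)
    obtain ⟨D, hD, hd⟩ := om_pow_mul_norm_le M (Lop n g)
    set B : ℝ := C + (2 * π) ^ (3 / 2 : ℝ) * (n * (n + 1) * D) with hB
    have hB0 : 0 ≤ B := by positivity
    refine ⟨B / (n + 1), by positivity, fun σ s u hσ hs => ?_⟩
    have hσ2 : σ ^ 2 = 1 := by rcases hσ with rfl | rfl <;> norm_num
    have hu : 0 < om u ^ M := pow_pos (om_pos u) M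
    have key := oscillator_backward (w := rem σ u (n + 1) g)
      (w1 := fun s => wd σ u g s - kst σ * ∑ k ∈ Finset.range (n + 1), Tkd σ k s * Lop k g u)
      (h := fun s => ((s ^ 2 : ℝ) : ℂ)⁻¹ *
        (rem σ u n (Aop g) s - kst σ * ((n : ℂ) * (n + 1) * Tk σ n s * Lop n g u)))
      (β := fun s => -((om u ^ M)⁻¹ * (B / (n + 1)) * s⁻¹ ^ (n + 1)))
      (β' := fun s => (om u ^ M)⁻¹ * B * s⁻¹ ^ (n + 2)) (p := s)
      (fun y hy => (hasDerivAt_wv σ u g (hc.trans_le (hs.trans hy))).sub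
        ((HasDerivAt.fun_sum fun k _ => (hasDerivAt_Tk σ k
          (hc.trans_le (hs.trans hy))).mul_const (Lop k g u)).const_mul (kst σ)))
      (fun y hy => hasDerivAt_rem_deriv hσ2 u n g (hc.trans_le (hs.trans hy)))
      (fun y hy => ?_) (fun y hy => ?_) (fun y hy => ?_) (tendsto_rem hσ u n g)
    · rw [neg_neg] at key
      calc om u ^ M * ‖rem σ u (n + 1) g s‖
          ≤ om u ^ M * ((om u ^ M)⁻¹ * (B / (n + 1)) * s⁻¹ ^ (n + 1)) := by gcongr
        _ = _ := by field_simp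
    · have hy0 : 0 < y := hc.trans_le (hs.trans hy)
      refine ((((hasDerivAt_inv hy0.ne').pow (n + 1)).const_mul
        ((om u ^ M)⁻¹ * (B / (n + 1)))).neg).congr_deriv ?_
      simp only [Nat.add_sub_cancel, inv_pow]
      push_cast
      field_simp
      ring
    · have hy0 : 0 < y := hc.trans_le (hs.trans hy)
      have h1 := h σ y u hσ (hs.trans hy)
      have h2 := hd u
      rw [norm_mul, norm_inv, Complex.norm_real, Real.norm_of_nonneg (by positivity),
        mul_assoc (om u ^ M)⁻¹, le_inv_mul_iff₀ hu]
      have h3 : ‖rem σ u n (Aop g) y - kst σ * ((n : ℂ) * (n + 1) * Tk σ n y * Lop n g u)‖ ≤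
          ‖rem σ u n (Aop g) y‖ + (2 * π) ^ (3 / 2 : ℝ) * (n * (n + 1) * y⁻¹ ^ n * ‖Lop n g u‖) := by
        refine (norm_sub_le _ _).trans_eq ?_
        rw [norm_mul, norm_kst, norm_mul, norm_mul, norm_mul, norm_Tk hσ2 n hy0, Complex.norm_natCast,
          show ((n : ℂ) + 1) = ((n + 1 : ℕ) : ℂ) by push_cast; rfl, Complex.norm_natCast]
        push_cast; rfl
      calc om u ^ M * ((y ^ 2)⁻¹ * ‖_‖) ≤ om u ^ M * ((y ^ 2)⁻¹ * (‖rem σ u n (Aop g) y‖ +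
            (2 * π) ^ (3 / 2 : ℝ) * (n * (n + 1) * y⁻¹ ^ n * ‖Lop n g u‖))) := by gcongr
        _ = (y ^ 2)⁻¹ * (om u ^ M * ‖rem σ u n (Aop g) y‖ + (2 * π) ^ (3 / 2 : ℝ) *
            (n * (n + 1) * y⁻¹ ^ n * (om u ^ M * ‖Lop n g u‖))) := by ring
        _ ≤ (y ^ 2)⁻¹ * (C * y⁻¹ ^ n + (2 * π) ^ (3 / 2 : ℝ) * (n * (n + 1) * y⁻¹ ^ n * D)) := by
          gcongr
        _ = B * y⁻¹ ^ (n + 2) := by rw [hB, pow_add, inv_pow y 2]; ring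
    · have hy0 : 0 < y := hc.trans_le (hs.trans hy)
      have : 0 ≤ (om u ^ M)⁻¹ * (B / (n + 1)) * y⁻¹ ^ (n + 1) := by positivity
      linarith

/-- The rescaled profile `q ↦ f (m q)`. -/
def scaled {m : ℝ} (hm : 0 < m) (f : 𝓢(V3, ℂ)) : 𝓢(V3, ℂ) :=
  SchwartzMap.compCLMOfContinuousLinearEquiv ℂ
    (ContinuousLinearEquiv.smulLeft (R₁ := ℝ) (M₁ := V3) (Units.mk0 m hm.ne')) f

lemma scaled_apply {m : ℝ} (hm : 0 < m) (f : 𝓢(V3, ℂ)) (q : V3) : scaled hm f q = f (m • q) := rfl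

lemma sqrt_mass {m : ℝ} (hm : 0 < m) (q : V3) :
    Real.sqrt (m ^ 2 + ‖m • q‖ ^ 2) = m * om q := by
  rw [om, norm_smul, Real.norm_of_nonneg hm.le,
    show m ^ 2 + (m * ‖q‖) ^ 2 = m ^ 2 * (1 + ‖q‖ ^ 2) by ring, Real.sqrt_mul (sq_nonneg m),
    Real.sqrt_sq hm.le]

lemma wavePacket_eq {m : ℝ} (hm : 0 < m) (f : 𝓢(V3, ℂ)) (x0 : ℝ) (x : V3) :
    wavePacket m f x0 x =
      ((m ^ 3 * (2 * π) ^ (-(3 : ℝ) / 2) : ℝ) : ℂ) * Wf (m * x0) (m • x) (scaled hm f) := by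
  rw [wavePacket, Wf_def]
  have h := Measure.integral_comp_smul_of_nonneg (volume : Measure V3) (fun p : V3 => f p *
      Complex.exp (-Complex.I * ((x0 * Real.sqrt (m ^ 2 + ‖p‖ ^ 2) - ⟪x, p⟫_ℝ : ℝ) : ℂ)) *
      (((m / Real.sqrt (m ^ 2 + ‖p‖ ^ 2) : ℝ)) : ℂ)) m (hR := hm.le)
  rw [eq_inv_smul_iff₀ (by positivity), finrank_euclideanSpace, Fintype.card_fin] at h
  rw [← h, Complex.real_smul, ← mul_assoc]
  congr 1
  · push_cast; ring
  · congr 1 with q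
    rw [sqrt_mass hm, Oi_apply, scaled_apply, ph, inner_smul_left, inner_smul_right,
      show m / (m * om q) = (om q)⁻¹ by field_simp]
    simp only [conj_trivial, ← mul_assoc, mul_comm x0 m]
    push_cast
    ring

lemma add_pow_mul_le {E ρ W C₀ C₁ : ℝ} (M : ℕ) (hE : 0 ≤ E) (hEρ : E ≤ 2 * ρ) (hW : 0 ≤ W)
    (h0 : W ≤ C₀) (h1 : ρ ^ M * W ≤ C₁) : (1 + E) ^ M * W ≤ 3 ^ M * (C₀ + C₁) := by
  have hρ : 0 ≤ ρ := by linarith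
  have hC1 : 0 ≤ C₁ := le_trans (by positivity) h1
  have hC0 : 0 ≤ C₀ := hW.trans h0
  rcases le_total ρ 1 with h | h
  · calc (1 + E) ^ M * W ≤ 3 ^ M * C₀ := by gcongr; linarith
      _ ≤ _ := by gcongr; linarith
  · calc (1 + E) ^ M * W ≤ (3 * ρ) ^ M * W := by gcongr; linarith
      _ = 3 ^ M * (ρ ^ M * W) := by rw [mul_pow, mul_assoc]
      _ ≤ _ := by gcongr; linarith

lemma Wf_outer {m : ℝ} (hm : 0 < m) (M : ℕ) (g : 𝓢(V3, ℂ)) : ∃ C, 0 ≤ C ∧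
    ∀ (x0 : ℝ) (x : V3), x0 ^ 2 - ‖x‖ ^ 2 < 1 →
      (1 + Real.sqrt (x0 ^ 2 + ‖x‖ ^ 2)) ^ M * ‖Wf (m * x0) (m • x) g‖ ≤ C := by
  obtain ⟨A, hA, ha⟩ := Wf_spacelike 0 g
  obtain ⟨B, hB, hb⟩ := Wf_spacelike M g
  obtain ⟨A', hA', ha'⟩ := Wf_timelike 0 g
  obtain ⟨B', hB', hb'⟩ := Wf_timelike M g
  refine ⟨3 ^ M * (A + (m ^ M)⁻¹ * B) + 3 ^ M * (A' + (m ^ M)⁻¹ * (B' * (1 + m ^ 2) ^ M)),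
    by positivity, fun x0 x hx => ?_⟩
  have hmM : 0 < m ^ M := by positivity
  have hnx : ‖m • x‖ = m * ‖x‖ := by rw [norm_smul, Real.norm_of_nonneg hm.le]
  have hn0 : |m * x0| = m * |x0| := by rw [abs_mul, abs_of_pos hm]
  rcases le_total |x0| ‖x‖ with h | h
  · have h1 : |m * x0| ≤ ‖m • x‖ := by rw [hnx, hn0]; gcongr
    have h2 := hb _ _ h1
    rw [hnx, mul_pow, mul_assoc, ← le_inv_mul_iff₀ hmM] at h2
    have h3 := ha _ _ h1
    rw [pow_zero, one_mul] at h3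
    refine (add_pow_mul_le M (Real.sqrt_nonneg _) ?_ (norm_nonneg _) h3 h2).trans
      (le_add_of_nonneg_right (by positivity))
    refine Real.sqrt_le_iff.2 ⟨by positivity, ?_⟩
    nlinarith [sq_abs x0, pow_le_pow_left₀ (abs_nonneg x0) h 2]
  · have h1 : ‖m • x‖ ≤ |m * x0| := by rw [hnx, hn0]; gcongr
    have hsq : ‖x‖ ^ 2 ≤ x0 ^ 2 := by rw [← sq_abs x0]; gcongr
    have h2 := hb' _ _ h1
    have h4 : B' * (1 + ((m * x0) ^ 2 - ‖m • x‖ ^ 2)) ^ M ≤ B' * (1 + m ^ 2) ^ M := by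
      rw [hnx]
      have : (m * x0) ^ 2 - (m * ‖x‖) ^ 2 = m ^ 2 * (x0 ^ 2 - ‖x‖ ^ 2) := by ring
      rw [this]
      have : 0 ≤ x0 ^ 2 - ‖x‖ ^ 2 := by linarith
      gcongr
      nlinarith [sq_nonneg m]
    replace h2 := h2.trans h4
    rw [hn0, mul_pow, mul_assoc, ← le_inv_mul_iff₀ hmM] at h2
    have h3 := ha' _ _ h1
    rw [pow_zero, one_mul, pow_zero, mul_one] at h3
    refine (add_pow_mul_le M (Real.sqrt_nonneg _) ?_ (norm_nonneg _) h3 h2).trans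
      (le_add_of_nonneg_left (by positivity))
    refine Real.sqrt_le_iff.2 ⟨by positivity, ?_⟩
    nlinarith [sq_abs x0]

lemma outer_bound {m : ℝ} (hm : 0 < m) (f : 𝓢(V3, ℂ)) (N : ℕ) : ∃ C, 0 ≤ C ∧
    ∀ (x0 : ℝ) (x : V3), x0 ^ 2 - ‖x‖ ^ 2 < 1 → ‖wavePacket m f x0 x‖ ≤
      C * (1 + Real.sqrt (x0 ^ 2 + ‖x‖ ^ 2)) ^ (-(N : ℝ) - 5 / 2) := by
  obtain ⟨C, hC, h⟩ := Wf_outer hm (N + 3) (scaled hm f)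
  refine ⟨m ^ 3 * (2 * π) ^ (-(3 : ℝ) / 2) * C, by positivity, fun x0 x hx => ?_⟩
  have h1 := h x0 x hx
  set Y := 1 + Real.sqrt (x0 ^ 2 + ‖x‖ ^ 2)
  have hY : 1 ≤ Y := le_add_of_nonneg_right (Real.sqrt_nonneg _)
  have hY0 : 0 < Y := by linarith
  rw [wavePacket_eq hm, norm_mul, Complex.norm_real, Real.norm_of_nonneg (by positivity), mul_assoc _ C]
  gcongr
  have h2 : Y ^ (-((N + 3 : ℕ) : ℝ)) ≤ Y ^ (-(N : ℝ) - 5 / 2) :=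
    Real.rpow_le_rpow_of_exponent_le hY (by push_cast; linarith)
  refine le_trans ?_ (mul_le_mul_of_nonneg_left h2 hC)
  rw [Real.rpow_neg hY0.le, Real.rpow_natCast, ← div_eq_mul_inv, le_div_iff₀ (by positivity)]
  linarith

lemma inner_bound {m : ℝ} (hm : 0 < m) (f : 𝓢(V3, ℂ)) (N : ℕ) : ∃ C, 0 ≤ C ∧
    ∀ (x0 : ℝ) (x : V3), 1 ≤ x0 ^ 2 - ‖x‖ ^ 2 →
      ∀ lam : ℝ, lam = Real.sign x0 * Real.sqrt (x0 ^ 2 - ‖x‖ ^ 2) →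
      ∀ u : V3, u = lam⁻¹ • x →
      ‖wavePacket m f x0 x -
        Complex.exp (-Complex.I * ((m * lam + Real.sign lam * (3 * π / 4) : ℝ) : ℂ)) *
          (((m / |lam|) ^ ((3 : ℝ) / 2) : ℝ) : ℂ) *
          ∑ k ∈ Finset.range (N + 1), (-Complex.I / ((m : ℂ) * (lam : ℂ))) ^ k *
            Lop k (scaled hm f) u‖ ≤
      C * (1 + Real.sqrt (x0 ^ 2 + ‖x‖ ^ 2)) ^ (-(N : ℝ) - 5 / 2) := by
  obtain ⟨C, hC, hr⟩ := rem_bound hm (N + 3) (N + 1) (scaled hm f)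
  set e : ℝ := (N : ℝ) + 5 / 2 with he
  refine ⟨m ^ 3 * (2 * π) ^ (-(3 : ℝ) / 2) * C * (3 / m) ^ e, by positivity,
    fun x0 x hx lam hlam u hu => ?_⟩
  have hx0 : x0 ≠ 0 := by
    rintro rfl
    nlinarith [sq_nonneg ‖x‖]
  set l := Real.sqrt (x0 ^ 2 - ‖x‖ ^ 2) with hl
  have hl1 : 1 ≤ l := Real.one_le_sqrt.2 hx
  have hl0 : 0 < l := by linarith
  have hl2 : l ^ 2 = x0 ^ 2 - ‖x‖ ^ 2 := Real.sq_sqrt (by linarith)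
  set σ := Real.sign x0 with hσd
  have hσ : σ = 1 ∨ σ = -1 := (Real.sign_apply_eq_of_ne_zero x0 hx0).symm
  have hσ2 : σ ^ 2 = 1 := by rcases hσ with h | h <;> rw [h] <;> norm_num
  have hσ0 : σ ≠ 0 := by rcases hσ with h | h <;> rw [h] <;> norm_num
  have hσabs : |σ| = 1 := by rcases hσ with h | h <;> rw [h] <;> simp
  have hlam0 : lam ≠ 0 := by rw [hlam]; positivity
  have hlamabs : |lam| = l := by rw [hlam, abs_mul, hσabs, one_mul, abs_of_pos hl0]
  have hsign : Real.sign lam = σ := by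
    rcases hσ with h | h <;> rw [hlam, h]
    · rw [one_mul, Real.sign_of_pos hl0]
    · rw [neg_one_mul, Real.sign_of_neg (by linarith)]
  have hxσ : x0 = σ * |x0| := by
    rcases lt_or_gt_of_ne hx0 with h | h
    · rw [hσd, Real.sign_of_neg h, abs_of_neg h]; ring
    · rw [hσd, Real.sign_of_pos h, abs_of_pos h]; ring
  have hxu : x = lam • u := by rw [hu, smul_inv_smul₀ hlam0]
  have hnx : ‖x‖ = l * ‖u‖ := by rw [hxu, norm_smul, Real.norm_eq_abs, hlamabs]
  have hom : |x0| = l * om u := by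
    rw [← sq_eq_sq₀ (abs_nonneg _) (mul_nonneg hl0.le (om_pos u).le), sq_abs, mul_pow, om_sq]
    rw [hnx] at hl2
    linear_combination -hl2
  set s := m * l with hs
  have hs0 : 0 < s := by positivity
  have hms : m ≤ s := le_mul_of_one_le_right hm.le hl1
  have hW : Wf (m * x0) (m • x) (scaled hm f) = Wray σ u (scaled hm f) s := by
    rw [Wray]
    congr 2
    · rw [hxσ, hom, hs]; ring
    · rw [hxu, smul_smul, hlam, hs]; congr 1; ring
  have hWv : Wray σ u (scaled hm f) s = ((s ^ (-(3 : ℝ) / 2) : ℝ) : ℂ) * wv σ u (scaled hm f) s := by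
    rw [wv, ← mul_assoc, ← Complex.ofReal_mul, ← Real.rpow_add hs0]
    norm_num
  have hconst : ((m / |lam|) ^ ((3 : ℝ) / 2) : ℝ) =
      m ^ 3 * (2 * π) ^ (-(3 : ℝ) / 2) * s ^ (-(3 : ℝ) / 2) * (2 * π) ^ (3 / 2 : ℝ) := by
    have h1 : (2 * π) ^ (-(3 : ℝ) / 2) * (2 * π) ^ (3 / 2 : ℝ) = 1 := by
      rw [← Real.rpow_add (by positivity)]; norm_num
    have h2 : s ^ (-(3 : ℝ) / 2) = m ^ (-(3 : ℝ) / 2) * l ^ (-(3 : ℝ) / 2) :=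
      Real.mul_rpow hm.le hl0.le
    have h3 : m ^ 3 * m ^ (-(3 : ℝ) / 2) = m ^ (3 / 2 : ℝ) := by
      rw [← Real.rpow_natCast, ← Real.rpow_add hm]; norm_num
    rw [hlamabs, Real.div_rpow hm.le hl0.le, ← h3, h2, div_eq_mul_inv, ← Real.rpow_neg hl0.le,
      show -((3 : ℝ) / 2) = -3 / 2 by ring]
    linear_combination -(m ^ 3 * m ^ (-(3 : ℝ) / 2) * l ^ (-(3 : ℝ) / 2)) * h1
  have hσc : (σ : ℂ) ^ 2 = 1 := by exact_mod_cast hσ2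
  have hsum : Complex.exp (-Complex.I * ((m * lam + Real.sign lam * (3 * π / 4) : ℝ) : ℂ)) *
        (((m / |lam|) ^ ((3 : ℝ) / 2) : ℝ) : ℂ) *
        ∑ k ∈ Finset.range (N + 1), (-Complex.I / ((m : ℂ) * (lam : ℂ))) ^ k *
            Lop k (scaled hm f) u =
      ((m ^ 3 * (2 * π) ^ (-(3 : ℝ) / 2) : ℝ) : ℂ) * ((s ^ (-(3 : ℝ) / 2) : ℝ) : ℂ) *
        (kst σ * ∑ k ∈ Finset.range (N + 1), Tk σ k s * Lop k (scaled hm f) u) := by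
    have hexp : Complex.exp (-Complex.I * ((m * lam + Real.sign lam * (3 * π / 4) : ℝ) : ℂ)) =
        Complex.exp (-(Complex.I * σ * s)) * Complex.exp (-(Complex.I * σ * (3 * π / 4))) := by
      rw [← Complex.exp_add, hsign, hlam, hs]
      congr 1
      push_cast
      ring
    have hz : -Complex.I / ((m : ℂ) * (lam : ℂ)) = -(Complex.I * σ) * (s : ℂ)⁻¹ := by
      have h1 : (m : ℂ) ≠ 0 := by exact_mod_cast hm.ne'
      have h2 : (l : ℂ) ≠ 0 := by exact_mod_cast hl0.ne'
      have h3 : (σ : ℂ) ≠ 0 := by exact_mod_cast hσ0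
      rw [hlam, hs]
      push_cast
      field_simp
      rw [hσc]
    have hT : ∑ k ∈ Finset.range (N + 1), Tk σ k s * Lop k (scaled hm f) u =
        Complex.exp (-(Complex.I * σ * s)) * ∑ k ∈ Finset.range (N + 1),
          (-Complex.I / ((m : ℂ) * (lam : ℂ))) ^ k * Lop k (scaled hm f) u := by
      rw [Finset.mul_sum]
      refine Finset.sum_congr rfl fun k _ => ?_
      rw [hz, Tk, mul_pow]
      ring
    rw [hT, hexp, hconst, kst]
    push_cast
    ring
  rw [hsum, wavePacket_eq hm, hW, hWv, ← mul_assoc, ← mul_sub, ← rem, norm_mul, norm_mul,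
    Complex.norm_real, Complex.norm_real, Real.norm_of_nonneg (by positivity),
    Real.norm_of_nonneg (by positivity)]
  set Y := 1 + Real.sqrt (x0 ^ 2 + ‖x‖ ^ 2)
  have hou := om_pos u
  have hou1 := one_le_om u
  have hY0 : 0 < Y := by positivity
  have hY : Y ≤ 3 / m * (s * om u) := by
    have h1 : Real.sqrt (x0 ^ 2 + ‖x‖ ^ 2) ≤ 2 * (l * om u) := by
      refine Real.sqrt_le_iff.2 ⟨by positivity, ?_⟩
      rw [← sq_abs x0, hom, hnx]
      have := norm_le_om u
      have : l * ‖u‖ ≤ l * om u := by gcongr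
      have := pow_le_pow_left₀ (by positivity) this 2
      nlinarith [sq_nonneg (l * om u)]
    have h2 : 1 ≤ l * om u := one_le_mul_of_one_le_of_one_le hl1 hou1
    have h3 : 3 / m * (s * om u) = 3 * (l * om u) := by rw [hs]; field_simp
    rw [h3]
    linarith
  have hYe : (3 / m) ^ (-e) * (s ^ (-e) * om u ^ (-e)) ≤ Y ^ (-e) := by
    rw [← Real.mul_rpow hs0.le hou.le, ← Real.mul_rpow (by positivity) (by positivity)]
    exact Real.rpow_le_rpow_of_nonpos hY0 hY (by rw [he]; linarith [(Nat.cast_nonneg N : (0 : ℝ) ≤ N)])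
  have hee : -(N : ℝ) - 5 / 2 = -e := by rw [he]; ring
  have hrem := hr σ s u hσ hms
  have hrem2 : ‖rem σ u (N + 1) (scaled hm f) s‖ ≤ C * s⁻¹ ^ (N + 1) * om u ^ (-e) := by
    have h1 : om u ^ (-((N + 3 : ℕ) : ℝ)) ≤ om u ^ (-e) :=
      Real.rpow_le_rpow_of_exponent_le hou1 (by rw [he]; push_cast; linarith)
    refine le_trans ?_ (mul_le_mul_of_nonneg_left h1 (by positivity))
    rw [Real.rpow_neg hou.le, Real.rpow_natCast, ← div_eq_mul_inv, le_div_iff₀ (by positivity)]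
    linarith
  have hse : s ^ (-(3 : ℝ) / 2) * s⁻¹ ^ (N + 1) = s ^ (-e) := by
    rw [inv_pow, ← Real.rpow_natCast, ← Real.rpow_neg hs0.le, ← Real.rpow_add hs0, he]
    congr 1; push_cast; ring
  have h3e : (3 / m) ^ e * (3 / m) ^ (-e) = 1 := by
    rw [← Real.rpow_add (by positivity)]; simp
  rw [hee]
  set K := m ^ 3 * (2 * π) ^ (-(3 : ℝ) / 2) with hK
  have hK0 : 0 ≤ K := by positivity
  calc K * s ^ (-(3 : ℝ) / 2) * ‖rem σ u (N + 1) (scaled hm f) s‖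
      ≤ K * s ^ (-(3 : ℝ) / 2) * (C * s⁻¹ ^ (N + 1) * om u ^ (-e)) := by gcongr
    _ = K * C * (3 / m) ^ e * ((3 / m) ^ (-e) * (s ^ (-e) * om u ^ (-e))) := by
      rw [← hse]
      linear_combination -(K * s ^ (-(3 : ℝ) / 2) * (C * s⁻¹ ^ (N + 1) * om u ^ (-e))) * h3e
    _ ≤ K * C * (3 / m) ^ e * Y ^ (-e) := by gcongr

lemma ofReal_smul_end (r : ℝ) (T : Module.End ℂ 𝓢(V3, ℂ)) : (r : ℂ) • T = r • T := by
  ext g u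
  simp

/-- Products of coordinate multiplications. -/
def Qlist (js : List (Fin 3)) : Module.End ℂ 𝓢(V3, ℂ) :=
  (js.map fun j => (Qm j : Module.End ℂ 𝓢(V3, ℂ))).prod

/-- Iterated partial derivatives on Schwartz functions. -/
def Plist (ls : List (Fin 3)) : Module.End ℂ 𝓢(V3, ℂ) :=
  (ls.map fun j => (Pd j : Module.End ℂ 𝓢(V3, ℂ))).prod

/-- Real combinations of normally ordered monomials of order at most `a` whose coefficients have
degree at most `b`. -/
def normalOps (a b : ℕ) : Submodule ℝ (Module.End ℂ 𝓢(V3, ℂ)) :=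
  Submodule.span ℝ {T | ∃ js ls : List (Fin 3), js.length ≤ b ∧ ls.length ≤ a ∧
    T = Qlist js * Plist ls}

lemma normalOps_mono {a a' b b' : ℕ} (ha : a ≤ a') (hb : b ≤ b') :
    normalOps a b ≤ normalOps a' b' :=
  Submodule.span_mono fun _ ⟨js, ls, h1, h2, h3⟩ => ⟨js, ls, h1.trans hb, h2.trans ha, h3⟩

lemma mem_normalOps {a b : ℕ} {js ls : List (Fin 3)} (hj : js.length ≤ b) (hl : ls.length ≤ a) :
    Qlist js * Plist ls ∈ normalOps a b := Submodule.subset_span ⟨js, ls, hj, hl, rfl⟩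

lemma mul_mem_normalOps {a b a' b' : ℕ} (Q : Module.End ℂ 𝓢(V3, ℂ))
    (h : ∀ js ls : List (Fin 3), js.length ≤ b → ls.length ≤ a →
      Q * (Qlist js * Plist ls) ∈ normalOps a' b')
    {T : Module.End ℂ 𝓢(V3, ℂ)} (hT : T ∈ normalOps a b) : Q * T ∈ normalOps a' b' := by
  induction hT using Submodule.span_induction with
  | mem T hT =>
    obtain ⟨js, ls, h1, h2, rfl⟩ := hT
    exact h js ls h1 h2
  | zero => rw [mul_zero]; exact zero_mem _
  | add T T' _ _ h1 h2 => rw [mul_add]; exact add_mem h1 h2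
  | smul r T _ h1 =>
    rw [← ofReal_smul_end, mul_smul_comm, ofReal_smul_end]
    exact Submodule.smul_mem _ r h1

lemma Qm_mul_mem {a b : ℕ} (i : Fin 3) {T : Module.End ℂ 𝓢(V3, ℂ)} (hT : T ∈ normalOps a b) :
    (Qm i : Module.End ℂ 𝓢(V3, ℂ)) * T ∈ normalOps a (b + 1) := by
  refine mul_mem_normalOps _ (fun js ls hj hl => ?_) hT
  have : (Qm i : Module.End ℂ 𝓢(V3, ℂ)) * (Qlist js * Plist ls) = Qlist (i :: js) * Plist ls := by
    simp [Qlist, mul_assoc]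
  rw [this]
  exact mem_normalOps (by simpa using hj) hl

lemma Pd_mul_Qm (i j : Fin 3) : (Pd i : Module.End ℂ 𝓢(V3, ℂ)) * Qm j =
    (if i = j then 1 else 0) + Qm j * Pd i := by
  ext1 g
  simp only [Module.End.mul_apply, Pd_Qm, LinearMap.add_apply]
  split_ifs <;> simp

lemma Pd_mul_mem {a b : ℕ} (i : Fin 3) {T : Module.End ℂ 𝓢(V3, ℂ)} (hT : T ∈ normalOps a b) :
    (Pd i : Module.End ℂ 𝓢(V3, ℂ)) * T ∈ normalOps (a + 1) b := by
  refine mul_mem_normalOps _ (fun js ls hj hl => ?_) hT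
  clear hT
  induction js generalizing b with
  | nil =>
    have : (Pd i : Module.End ℂ 𝓢(V3, ℂ)) * (Qlist [] * Plist ls) = Qlist [] * Plist (i :: ls) := by
      simp [Qlist, Plist]
    rw [this]
    exact mem_normalOps hj (by simpa using hl)
  | cons j js ih =>
    obtain ⟨b, rfl⟩ : ∃ b', b = b' + 1 := ⟨b - 1, by simp at hj; omega⟩
    have hj' : js.length ≤ b := by simpa using hj
    have h1 : (Pd i : Module.End ℂ 𝓢(V3, ℂ)) * (Qlist (j :: js) * Plist ls) =
        (if i = j then 1 else 0) * (Qlist js * Plist ls) +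
          Qm j * ((Pd i : Module.End ℂ 𝓢(V3, ℂ)) * (Qlist js * Plist ls)) := by
      have : Qlist (j :: js) = Qm j * Qlist js := by simp [Qlist]
      rw [this, mul_assoc, ← mul_assoc (Pd i : Module.End ℂ 𝓢(V3, ℂ)), Pd_mul_Qm, add_mul, mul_assoc]
    rw [h1]
    refine add_mem ?_ (Qm_mul_mem j (ih hj'))
    split_ifs
    · rw [one_mul]; exact mem_normalOps (hj'.trans (Nat.le_succ _)) (hl.trans (Nat.le_succ _))
    · rw [zero_mul]; exact zero_mem _

lemma Aop_eq : (Aop : Module.End ℂ 𝓢(V3, ℂ)) =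
    ∑ j, (Pd j : Module.End ℂ 𝓢(V3, ℂ)) * Pd j +
      ∑ j, ∑ i, (Qm j : Module.End ℂ 𝓢(V3, ℂ)) * (Qm i * (Pd j * Pd i)) +
      (3 : ℝ) • ∑ j, (Qm j : Module.End ℂ 𝓢(V3, ℂ)) * Pd j +
      (3 / 4 : ℝ) • (1 : Module.End ℂ 𝓢(V3, ℂ)) := by
  rw [← ofReal_smul_end, ← ofReal_smul_end]
  push_cast
  rfl

lemma Aop_mul_mem {a b : ℕ} {T : Module.End ℂ 𝓢(V3, ℂ)} (hT : T ∈ normalOps a b) :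
    (Aop : Module.End ℂ 𝓢(V3, ℂ)) * T ∈ normalOps (a + 2) (b + 2) := by
  rw [Aop_eq]
  simp only [add_mul, Finset.sum_mul, smul_mul_assoc, mul_assoc, one_mul]
  refine add_mem (add_mem (add_mem (sum_mem fun j _ => ?_) (sum_mem fun j _ => sum_mem fun i _ => ?_))
    (Submodule.smul_mem _ _ (sum_mem fun j _ => ?_))) (Submodule.smul_mem _ _ ?_)
  · exact normalOps_mono le_rfl (by omega) (Pd_mul_mem j (Pd_mul_mem j hT))
  · exact Qm_mul_mem j (Qm_mul_mem i (Pd_mul_mem j (Pd_mul_mem i hT)))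
  · exact normalOps_mono (by omega) (by omega) (Qm_mul_mem j (Pd_mul_mem j hT))
  · exact normalOps_mono (by omega) (by omega) hT

lemma Lop_mem (k : ℕ) : Lop k ∈ normalOps (2 * k) (2 * k) := by
  induction k with
  | zero =>
    have : Lop 0 = Qlist [] * Plist [] := by simp [Lop, Qlist, Plist]
    rw [this]
    exact mem_normalOps le_rfl le_rfl
  | succ k ih =>
    have h : Lop (k + 1) = (1 / (2 * ((k : ℝ) + 1))) •
        ((Aop : Module.End ℂ 𝓢(V3, ℂ)) * Lop k - ((k : ℝ) * (k + 1)) • Lop k) := by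
      rw [← ofReal_smul_end, ← ofReal_smul_end, Lop, sub_mul, smul_mul_assoc, one_mul]
      push_cast
      rfl
    rw [h]
    exact Submodule.smul_mem _ _ (sub_mem (Aop_mul_mem ih)
      (Submodule.smul_mem _ _ (normalOps_mono (by omega) (by omega) ih)))

lemma pderivList_eq (ls : List (Fin 3)) (g : 𝓢(V3, ℂ)) : pderivList ls g = Plist ls g := by
  induction ls with
  | nil => simp [pderivList, Plist]
  | cons i ls ih =>
    ext u
    have : Plist (i :: ls) = Pd i * Plist ls := by simp [Plist]
    rw [pderivList, ih, this, Module.End.mul_apply, Pd_apply]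
    rfl

lemma Qlist_apply (js : List (Fin 3)) (g : 𝓢(V3, ℂ)) (u : V3) :
    Qlist js g u = ((MvPolynomial.eval (![Real.sqrt (1 + ‖u‖ ^ 2), u 0, u 1, u 2])
      ((js.map fun j => (MvPolynomial.X j.succ : MvPolynomial (Fin 4) ℝ)).prod) : ℝ) : ℂ) * g u := by
  induction js with
  | nil => simp [Qlist]
  | cons j js ih =>
    have : Qlist (j :: js) = Qm j * Qlist js := by simp [Qlist]
    have h2 : (![Real.sqrt (1 + ‖u‖ ^ 2), u 0, u 1, u 2] : Fin 4 → ℝ) j.succ = u j := by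
      fin_cases j <;> rfl
    rw [this, Module.End.mul_apply, Qm_apply, ih, List.map_cons, List.prod_cons, map_mul,
      MvPolynomial.eval_X, h2]
    push_cast
    ring

/-- All lists of directions of length at most `a`. -/
def indexLists (a : ℕ) : Finset (List (Fin 3)) := (List.finite_length_le (Fin 3) a).toFinset

lemma mem_indexLists {a : ℕ} {ls : List (Fin 3)} : ls ∈ indexLists a ↔ ls.length ≤ a := by
  simp [indexLists]

lemma totalDegree_list_X (js : List (Fin 3)) :
    ((js.map fun j => (MvPolynomial.X j.succ : MvPolynomial (Fin 4) ℝ)).prod).totalDegree ≤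
      js.length := by
  induction js with
  | nil => simp
  | cons j js ih =>
    rw [List.map_cons, List.prod_cons]
    refine (MvPolynomial.totalDegree_mul _ _).trans ?_
    rw [MvPolynomial.totalDegree_X, List.length_cons]
    omega

lemma exists_applyOp {a b : ℕ} {T : Module.End ℂ 𝓢(V3, ℂ)} (hT : T ∈ normalOps a b) :
    ∃ c : List (Fin 3) → MvPolynomial (Fin 4) ℝ, (∀ ls, (c ls).totalDegree ≤ b) ∧
      ∀ (g : 𝓢(V3, ℂ)) (u : V3), T g u = applyOp (indexLists a) c g u := by
  induction hT using Submodule.span_induction with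
  | mem T hT =>
    obtain ⟨js, ls, h1, h2, rfl⟩ := hT
    refine ⟨fun l => if l = ls then
      (js.map fun j => (MvPolynomial.X j.succ : MvPolynomial (Fin 4) ℝ)).prod else 0,
      fun l => ?_, fun g u => ?_⟩
    · dsimp only
      split_ifs
      · exact (totalDegree_list_X js).trans h1
      · simp
    · rw [applyOp, Finset.sum_eq_single ls (fun l _ hl => by simp [hl])
        (fun h => absurd (mem_indexLists.2 h2) h), if_pos rfl, Module.End.mul_apply, Qlist_apply,
        pderivList_eq]
  | zero => exact ⟨0, fun ls => by simp, fun g u => by simp [applyOp]⟩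
  | add T T' _ _ h h' =>
    obtain ⟨c, hc, hT⟩ := h
    obtain ⟨c', hc', hT'⟩ := h'
    refine ⟨c + c', fun ls => (MvPolynomial.totalDegree_add _ _).trans (max_le (hc ls) (hc' ls)),
      fun g u => ?_⟩
    rw [LinearMap.add_apply, add_apply, hT, hT', applyOp, applyOp, applyOp,
      ← Finset.sum_add_distrib]
    refine Finset.sum_congr rfl fun l _ => ?_
    rw [Pi.add_apply, map_add]
    push_cast
    ring
  | smul r T _ h =>
    obtain ⟨c, hc, hT⟩ := h
    refine ⟨fun l => r • c l, fun l => (MvPolynomial.totalDegree_smul_le _ _).trans (hc l),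
      fun g u => ?_⟩
    rw [LinearMap.smul_apply, smul_apply, hT, applyOp, applyOp, Finset.smul_sum]
    refine Finset.sum_congr rfl fun l _ => ?_
    rw [MvPolynomial.smul_eval, Complex.real_smul]
    push_cast
    ring

theorem klein_gordon_packet_asymptotics :
    ∃ (S : ℕ → Finset (List (Fin 3))) (c : ℕ → List (Fin 3) → MvPolynomial (Fin 4) ℝ),
      -- each L_k has order at most 2k
      (∀ k : ℕ, ∀ ls ∈ S k, ls.length ≤ 2 * k) ∧
      -- coefficients are real polynomials of degree at most 2k
      (∀ k : ℕ, ∀ ls : List (Fin 3), (c k ls).totalDegree ≤ 2 * k) ∧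
      -- L₀ is the identity operator
      (∀ (g : V3 → ℂ) (u : V3), applyOp (S 0) (c 0) g u = g u) ∧
      -- asymptotic expansion, uniform bounds
      (∀ m : ℝ, 0 < m → ∀ f : SchwartzMap V3 ℂ, ∀ N : ℕ, ∃ C : ℝ,
        ∀ (x0 : ℝ) (xv : V3),
          -- (i) timelike region x·x ≥ 1
          (1 ≤ x0 ^ 2 - ‖xv‖ ^ 2 →
            ∀ lam : ℝ, lam = Real.sign x0 * Real.sqrt (x0 ^ 2 - ‖xv‖ ^ 2) →
            ∀ uv : V3, uv = lam⁻¹ • xv →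
              ‖wavePacket m f x0 xv -
                Complex.exp (-Complex.I * ((m * lam + Real.sign lam * (3 * π / 4) : ℝ) : ℂ)) *
                  (((m / |lam|) ^ ((3 : ℝ) / 2) : ℝ) : ℂ) *
                  ∑ k ∈ Finset.range (N + 1),
                    (-Complex.I / ((m : ℂ) * (lam : ℂ))) ^ k *
                      applyOp (S k) (c k) (fun w => f (m • w)) uv‖ ≤
                C * (1 + Real.sqrt (x0 ^ 2 + ‖xv‖ ^ 2)) ^ (-(N : ℝ) - 5 / 2)) ∧
          -- (ii) complement x·x < 1
          (x0 ^ 2 - ‖xv‖ ^ 2 < 1 →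
            ‖wavePacket m f x0 xv‖ ≤
              C * (1 + Real.sqrt (x0 ^ 2 + ‖xv‖ ^ 2)) ^ (-(N : ℝ) - 5 / 2))) := by
  have hrep : ∀ k, ∃ (S : Finset (List (Fin 3))) (c : List (Fin 3) → MvPolynomial (Fin 4) ℝ),
      (∀ ls ∈ S, ls.length ≤ 2 * k) ∧ (∀ ls, (c ls).totalDegree ≤ 2 * k) ∧
      (k = 0 → ∀ (g : V3 → ℂ) (u : V3), applyOp S c g u = g u) ∧
      ∀ (g : 𝓢(V3, ℂ)) (u : V3), Lop k g u = applyOp S c g u := by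
    intro k
    rcases Nat.eq_zero_or_pos k with rfl | hk
    · have h : ∀ (g : V3 → ℂ) (u : V3), applyOp {[]} (fun _ => 1) g u = g u := fun g u => by
        simp [applyOp, pderivList]
      exact ⟨{[]}, fun _ => 1, by simp, by simp, fun _ => h, fun g u => by rw [h]; rfl⟩
    · obtain ⟨c, hc, h⟩ := exists_applyOp (Lop_mem k)
      exact ⟨indexLists (2 * k), c, fun ls hls => mem_indexLists.1 hls, hc,
        fun h0 => absurd h0 hk.ne', h⟩
  choose S c hS hc h0 hL using hrep
  refine ⟨S, c, hS, hc, h0 0 rfl, fun m hm f N => ?_⟩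
  obtain ⟨C₁, hC₁, h₁⟩ := inner_bound hm f N
  obtain ⟨C₂, hC₂, h₂⟩ := outer_bound hm f N
  refine ⟨C₁ + C₂, fun x0 xv => ⟨fun hx lam hlam uv huv => ?_, fun hx => ?_⟩⟩
  · have h := h₁ x0 xv hx lam hlam uv huv
    simp only [hL] at h
    exact h.trans (by gcongr; linarith)
  · exact (h₂ x0 xv hx).trans (by gcongr; linarith)

end
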